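/- arXiv:1810.04439 — 3 statements merged into one kernel-verified Lean document; each statement's English description precedes it below -/
import Mathlib

section
/- Let n ≥ 2 and let A be a singular n×n (−1,1)-matrix whose rank over ℚ equals k (so 1 ≤ k ≤ n−1). Then |per A| ≤ per D_{(n,k−1)}. Moreover, if |per A| = per D_{(n,k−1)}, then A can be obtained from D_{(n,k−1)} by standard transformations. -/
open Matrix

/-- The permanent of a square matrix. -/
def per {n : ℕ} (A : Matrix (Fin n) (Fin n) ℚ) : ℚ :=
  ∑ σ : Equiv.Perm (Fin n), ∏ i, A i (σ i)

/-- The square matrix `D_{(n,l)}`: `-1` on the first `l` diagonal entries, `1` elsewhere. -/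
def Dmat (n l : ℕ) : Matrix (Fin n) (Fin n) ℚ :=
  fun i j => if (i : ℕ) = (j : ℕ) ∧ (j : ℕ) < l then -1 else 1

/-- `A` is obtained from `B` by standard transformations: a finite composition of row
permutations, column permutations, multiplications of rows/columns by `-1`, and
transposition (square case). -/
def StdEquiv {n : ℕ} (A B : Matrix (Fin n) (Fin n) ℚ) : Prop :=
  ∃ (ρ σ : Equiv.Perm (Fin n)) (ε δ : Fin n → ℚ),
    (∀ i, ε i = 1 ∨ ε i = -1) ∧ (∀ j, δ j = 1 ∨ δ j = -1) ∧
    ((∀ i j, A i j = ε i * δ j * B (ρ i) (σ j)) ∨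
     (∀ i j, A i j = ε i * δ j * B (σ j) (ρ i)))

/-- `perD a l` is the permanent of `D_{(a+l,l)}`, given by its recursion. -/
def perD : ℕ → ℕ → ℤ
  | a, 0 => a.factorial
  | a, l + 1 => perD (a + 1) l - 2 * perD a l

theorem perD_zero (a : ℕ) : perD a 0 = a.factorial := by simp [perD]

theorem perD_succ (a l : ℕ) : perD a (l + 1) = perD (a + 1) l - 2 * perD a l := by
  simp [perD]

/-- Laplace expansion of `perD` along a row of ones. -/
theorem perD_laplace (a l : ℕ) :
    perD (a + 1) (l + 1) = (a + 1) * perD a (l + 1) + (l + 1) * perD (a + 1) l := by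
  induction l generalizing a with
  | zero =>
    simp only [perD_succ, perD_zero, Nat.factorial_succ]
    push_cast
    ring
  | succ l ih =>
    have h1 := ih (a + 1)
    have h2 := ih a
    have e1 := perD_succ (a + 1) (l + 1)
    have e2 := perD_succ a (l + 1)
    have e3 := perD_succ (a + 1) l
    push_cast at *
    linear_combination e1 + h1 - (a + 1) * e2 - 2 * h2 - (l + 1) * e3

theorem perD_laplace_zero (a : ℕ) : perD (a + 1) 0 = (a + 1) * perD a 0 := by
  simp only [perD_zero, Nat.factorial_succ]
  push_cast
  ring

theorem perD_three_term (a l : ℕ) :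
    perD (a + 2) l = (a + l + 4) * perD (a + 1) l - 2 * (a + 1) * perD a l := by
  have h := perD_laplace a l
  rw [perD_succ, perD_succ] at h
  linear_combination h

theorem perD_one_bound (l : ℕ) :
    0 ≤ perD 0 (l + 4) ∧ 2 * perD 0 (l + 4) ≤ perD 1 (l + 4) := by
  induction l with
  | zero => decide
  | succ l ih =>
    have h1 := perD_laplace 0 (l + 4)
    have h2 := perD_succ 0 (l + 4)
    have e : l + 1 + 4 = l + 4 + 1 := by omega
    rw [e]
    push_cast at *
    have : (0 : ℤ) ≤ l * perD 1 (l + 4) := mul_nonneg (by positivity) (by linarith)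
    constructor <;> nlinarith

theorem perD_one_nonneg (l : ℕ) : 0 ≤ perD 1 l := by
  obtain h | ⟨m, rfl⟩ : l < 4 ∨ ∃ m, l = m + 4 := by
    rcases lt_or_ge l 4 with h | h
    · exact .inl h
    · exact .inr ⟨l - 4, by omega⟩
  · interval_cases l <;> decide
  · have := perD_one_bound m
    linarith

theorem perD_nonneg_and_pos (a l : ℕ) : 0 ≤ perD (a + 1) l ∧ 0 < perD (a + 2) l := by
  induction a generalizing l with
  | zero =>
    refine ⟨perD_one_nonneg l, ?_⟩
    induction l with
    | zero => decide
    | succ l ih =>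
      have h := perD_laplace 1 l
      have := perD_one_nonneg (l + 1)
      push_cast at h
      nlinarith
  | succ a ih =>
    refine ⟨(ih l).2.le, ?_⟩
    induction l with
    | zero =>
      rw [perD_zero]
      exact_mod_cast Nat.factorial_pos _
    | succ l ihl =>
      have h := perD_laplace (a + 2) l
      have := (ih (l + 1)).2
      push_cast at h
      have h1 : 0 < ((a : ℤ) + 2 + 1) * perD (a + 2) (l + 1) := by positivity
      have h2 : 0 < ((l : ℤ) + 1) * perD (a + 2 + 1) l := by positivity
      have e : a + 1 + 2 = a + 2 + 1 := by omega
      rw [e]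
      linarith

theorem perD_nonneg (a l : ℕ) (ha : 1 ≤ a) : 0 ≤ perD a l := by
  obtain ⟨b, rfl⟩ := Nat.exists_eq_add_of_le' ha
  exact (perD_nonneg_and_pos b l).1

theorem perD_pos (a l : ℕ) (ha : 2 ≤ a) : 0 < perD a l := by
  obtain ⟨b, rfl⟩ := Nat.exists_eq_add_of_le' ha
  exact (perD_nonneg_and_pos b l).2

/-- For fixed `n`, `per D_{(n,l)}` is antitone in `l < n`. -/
theorem perD_antitone {n l u : ℕ} (hlu : l ≤ u) (hun : u + 1 ≤ n) :
    perD (n - u) u ≤ perD (n - l) l := by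
  induction u, hlu using Nat.le_induction with
  | base => rfl
  | succ u _ ih =>
    refine le_trans ?_ (ih (by omega))
    have h := perD_succ (n - (u + 1)) u
    have h' := perD_nonneg (n - (u + 1)) u (by omega)
    rw [show n - (u + 1) + 1 = n - u by omega] at h
    linarith

/-- The estimate of a double Laplace expansion along two distant rows. -/
theorem perD_two_row_lt (a j : ℕ) (ha : 2 ≤ a) :
    ((a + j + 1) * (a + j) + 2) * perD a (j + 1) + 2 * ((j + 2) * (j + 1)) * perD a j
      < perD a (j + 3) := by
  obtain ⟨b, rfl⟩ := Nat.exists_eq_add_of_le' ha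
  have hpos := perD_pos (b + 2) j (by omega)
  have hnn := perD_nonneg (b + 1) j (by omega)
  have hge : ((b : ℤ) + 2) * perD (b + 1) j ≤ perD (b + 2) j := by
    cases j with
    | zero =>
      have := perD_laplace_zero (b + 1)
      push_cast at this
      linarith
    | succ j =>
      have h := perD_laplace (b + 1) j
      have h' := perD_nonneg (b + 2) j (by omega)
      have : (0 : ℤ) ≤ (j + 1) * perD (b + 2) j := by positivity
      push_cast at h
      rw [show b + 1 + 1 = b + 2 by omega] at h
      linarith
  have h3 := perD_three_term (b + 1) j
  have h4 := perD_three_term (b + 2) j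
  have h5 := perD_three_term (b + 3) j
  have e1 : perD (b + 2) (j + 1) = perD (b + 3) j - 2 * perD (b + 2) j := perD_succ _ _
  have e2 : perD (b + 2) (j + 3)
      = perD (b + 5) j - 6 * perD (b + 4) j + 12 * perD (b + 3) j - 8 * perD (b + 2) j := by
    simp only [perD_succ, add_assoc, Nat.reduceAdd]
    ring
  simp only [add_assoc, Nat.reduceAdd] at h3 h4 h5
  rw [e1, e2]
  push_cast at *
  rw [h5, h4, h3]
  have hb : (0 : ℤ) ≤ b := by positivity
  have hj : (0 : ℤ) ≤ j := by positivity
  have hlt : 2 * ((b : ℤ) + 2) * perD (b + 1) j < (2 * (b + 2) + j) * perD (b + 2) j := by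
    nlinarith [mul_nonneg hj hpos.le, mul_nonneg hb hpos.le, mul_nonneg hb hnn]
  have := mul_pos (by positivity : (0 : ℤ) < 2 * (j + 1)) (sub_pos.2 hlt)
  nlinarith

theorem per_transpose {n : ℕ} (A : Matrix (Fin n) (Fin n) ℚ) : per Aᵀ = per A :=
  (permanent_transpose A).symm

theorem per_submatrix {n : ℕ} (A : Matrix (Fin n) (Fin n) ℚ) (ρ σ : Equiv.Perm (Fin n)) :
    per (A.submatrix ρ σ) = per A := by
  have h (M : Matrix (Fin n) (Fin n) ℚ) : per M = M.permanent := by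
    rw [← per_transpose]; rfl
  rw [h, h, ← permanent_permute_cols ρ A, ← permanent_permute_rows σ (A.submatrix ρ id)]
  rfl

theorem per_scale {n : ℕ} (A : Matrix (Fin n) (Fin n) ℚ) (ε δ : Fin n → ℚ) :
    per (Matrix.of fun i j => ε i * δ j * A i j) = (∏ i, ε i) * (∏ j, δ j) * per A := by
  simp only [per, Finset.mul_sum, of_apply, Finset.prod_mul_distrib]
  refine Finset.sum_congr rfl fun σ _ => ?_
  rw [Equiv.prod_comp σ δ]

theorem abs_prod_eq_one {ι : Type*} (s : Finset ι) (ε : ι → ℚ)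
    (hε : ∀ i, ε i = 1 ∨ ε i = -1) : |∏ i ∈ s, ε i| = 1 := by
  rw [Finset.abs_prod]
  exact Finset.prod_eq_one fun i _ => by rcases hε i with h | h <;> simp [h]

theorem abs_per_scale {n : ℕ} (A : Matrix (Fin n) (Fin n) ℚ) (ε δ : Fin n → ℚ)
    (hε : ∀ i, ε i = 1 ∨ ε i = -1) (hδ : ∀ j, δ j = 1 ∨ δ j = -1) :
    |per (Matrix.of fun i j => ε i * δ j * A i j)| = |per A| := by
  rw [per_scale, abs_mul, abs_mul, abs_prod_eq_one _ ε hε, abs_prod_eq_one _ δ hδ, one_mul,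
    one_mul]

theorem StdEquiv.abs_per {n : ℕ} {A B : Matrix (Fin n) (Fin n) ℚ} (h : StdEquiv A B) :
    |per A| = |per B| := by
  obtain ⟨ρ, σ, ε, δ, hε, hδ, h | h⟩ := h
  · rw [← per_submatrix B ρ σ, ← abs_per_scale (B.submatrix ρ σ) ε δ hε hδ]
    congr 2
    ext i j
    exact h i j
  · rw [← per_transpose B, ← per_submatrix Bᵀ ρ σ, ← abs_per_scale (Bᵀ.submatrix ρ σ) ε δ hε hδ]
    congr 2
    ext i j
    exact h i j

theorem StdEquiv.rank_eq {n : ℕ} {A B : Matrix (Fin n) (Fin n) ℚ} (h : StdEquiv A B) :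
    A.rank = B.rank := by
  obtain ⟨ρ, σ, ε, δ, hε, hδ, h⟩ := h
  have unit (v : Fin n → ℚ) (hv : ∀ i, v i = 1 ∨ v i = -1) : IsUnit (diagonal v).det := by
    rw [det_diagonal, isUnit_iff_ne_zero, ← abs_ne_zero, abs_prod_eq_one _ v hv]
    exact one_ne_zero
  have key (M : Matrix (Fin n) (Fin n) ℚ) (hM : ∀ i j, A i j = ε i * δ j * M (ρ i) (σ j)) :
      A.rank = M.rank := by
    have e : A = diagonal ε * M.submatrix ρ σ * diagonal δ := by
      ext i j
      rw [mul_diagonal, diagonal_mul, hM, submatrix_apply]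
      ring
    rw [e, rank_mul_eq_left_of_isUnit_det _ _ (unit δ hδ),
      rank_mul_eq_right_of_isUnit_det _ _ (unit ε hε), rank_submatrix]
  rcases h with h | h
  · exact key B h
  · rw [← rank_transpose B]
    exact key Bᵀ h

theorem per_laplace {n : ℕ} (A : Matrix (Fin (n + 1)) (Fin (n + 1)) ℚ) (i : Fin (n + 1)) :
    per A = ∑ j, A i j * per (A.submatrix i.succAbove j.succAbove) := by
  let f : Fin (n + 1) × Equiv.Perm (Fin n) → Equiv.Perm (Fin (n + 1)) := fun p =>
    (finSuccEquiv' i).trans (p.2.optionCongr.trans (finSuccEquiv' p.1).symm)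
  have f0 (p) : f p i = p.1 := by simp [f]
  have fs (p) (k : Fin n) : f p (i.succAbove k) = p.1.succAbove (p.2 k) := by simp [f]
  have hf : Function.Bijective f := by
    rw [Fintype.bijective_iff_injective_and_card]
    refine ⟨fun p q h => ?_, by simp [Fintype.card_perm, Nat.factorial_succ]⟩
    have h0 : p.1 = q.1 := by rw [← f0, ← f0, h]
    refine Prod.ext h0 (Equiv.ext fun k => ?_)
    apply Fin.succAbove_right_injective (p := p.1)
    rw [← fs, h, fs, h0]
  simp only [per]
  rw [← Function.Bijective.sum_comp hf, Fintype.sum_prod_type]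
  refine Finset.sum_congr rfl fun j _ => ?_
  rw [Finset.mul_sum]
  refine Finset.sum_congr rfl fun e _ => ?_
  rw [Fin.prod_univ_succAbove _ i, f0]
  simp [fs]

theorem abs_per_le_factorial {n : ℕ} (A : Matrix (Fin n) (Fin n) ℚ) (hA : ∀ i j, |A i j| ≤ 1) :
    |per A| ≤ n.factorial := by
  refine (Finset.abs_sum_le_sum_abs _ _).trans ?_
  refine (Finset.sum_le_card_nsmul _ _ 1 fun σ _ => ?_).trans ?_
  · rw [Finset.abs_prod]
    exact Finset.prod_le_one (fun _ _ => abs_nonneg _) fun i _ => hA i _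
  · simp [Finset.card_univ, Fintype.card_perm]

theorem per_Dmat (n l : ℕ) (hl : l ≤ n) : per (Dmat n l) = perD (n - l) l := by
  induction l generalizing n with
  | zero =>
    simp [per, Dmat, perD_zero, Finset.card_univ, Fintype.card_perm]
  | succ l ih =>
    obtain ⟨n, rfl⟩ := Nat.exists_eq_add_of_le' (by omega : 1 ≤ n)
    let i : Fin (n + 1) := ⟨l, by omega⟩
    have hsub : (Dmat (n + 1) (l + 1)).submatrix i.succAbove i.succAbove = Dmat n l := by
      ext a b
      simp only [submatrix_apply, Dmat, Fin.succAbove, i, Fin.lt_def, Fin.val_castSucc]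
      split_ifs <;> simp_all <;> omega
    have hmin (j : Fin (n + 1)) : (Dmat (n + 1) (l + 1)).submatrix i.succAbove j.succAbove
        = (Dmat (n + 1) l).submatrix i.succAbove j.succAbove := by
      ext a b
      have := Fin.val_ne_of_ne (Fin.succAbove_ne i a)
      simp only [submatrix_apply, Dmat]
      simp only [i] at this ⊢
      congr 1
      apply propext
      constructor <;> rintro ⟨h1, h2⟩ <;> refine ⟨h1, ?_⟩ <;> omega
    have hrow (j) : Dmat (n + 1) (l + 1) i j = Dmat (n + 1) l i j - if j = i then 2 else 0 := by
      simp only [Dmat, i, Fin.ext_iff]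
      split_ifs <;> first | omega | norm_num
    have h1 : per (Dmat (n + 1) (l + 1)) = per (Dmat (n + 1) l) - 2 * per (Dmat n l) := by
      rw [per_laplace _ i, per_laplace (Dmat (n + 1) l) i]
      simp only [hrow, sub_mul, Finset.sum_sub_distrib, ite_mul, zero_mul,
        Finset.sum_ite_eq', Finset.mem_univ, if_true, hsub]
      simp only [hmin]
    rw [h1, ih _ (by omega), ih _ (by omega), show n + 1 - (l + 1) = n - l by omega, perD_succ,
      show n - l + 1 = n + 1 - l by omega]
    push_cast
    rfl

theorem rank_Dmat (n u : ℕ) (hu : u + 1 ≤ n) : (Dmat n u).rank = u + 1 := by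
  apply le_antisymm
  · let X : Matrix (Fin n) (Fin (u + 1)) ℚ :=
      of fun i => Fin.cons 1 fun k => if (i : ℕ) = k then -2 else 0
    let Y : Matrix (Fin (u + 1)) (Fin n) ℚ :=
      of (Fin.cons 1 fun k j => if (j : ℕ) = k then 1 else 0)
    have hXY : Dmat n u = X * Y := by
      ext i j
      simp only [Dmat, mul_apply, X, Y, of_apply, Fin.sum_univ_succ, Fin.cons_zero,
        Fin.cons_succ, Pi.one_apply, mul_one, mul_ite, mul_zero]
      by_cases hj : (j : ℕ) < u
      · rw [Finset.sum_eq_single ⟨j, hj⟩]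
        · by_cases h : (i : ℕ) = j <;> simp [h, hj]
          norm_num
        · intro b _ hb
          rw [if_neg]
          exact fun h => hb (Fin.ext h.symm)
        · simp
      · rw [if_neg (by tauto), Finset.sum_eq_zero, add_zero]
        intro k _
        rw [if_neg (by omega)]
    rw [hXY]
    exact (rank_mul_le_right X Y).trans (rank_le_height Y)
  · have hdet : (Dmat (u + 1) u).det ≠ 0 := by
      rw [Ne, ← exists_mulVec_eq_zero_iff]
      rintro ⟨v, hv, h⟩
      have hrow (i : Fin (u + 1)) : ∑ j, v j - (if (i : ℕ) < u then 2 * v i else 0) = 0 := by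
        refine Eq.trans ?_ (congrFun h i)
        simp only [mulVec, dotProduct, Dmat]
        rw [← Finset.add_sum_erase _ v (Finset.mem_univ i),
          ← Finset.add_sum_erase Finset.univ (fun j => _ * v j) (Finset.mem_univ i)]
        have hrest : ∑ j ∈ Finset.univ.erase i,
            (if (i : ℕ) = j ∧ (j : ℕ) < u then (-1 : ℚ) else 1) * v j =
              ∑ j ∈ Finset.univ.erase i, v j := by
          refine Finset.sum_congr rfl fun j hj => ?_
          rw [if_neg, one_mul]
          rintro ⟨h1, -⟩
          exact (Finset.ne_of_mem_erase hj) (Fin.ext h1.symm)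
        rw [hrest]
        by_cases hi : (i : ℕ) < u
        · simp only [hi, and_self, if_true]
          ring
        · simp [hi]
      have hsum : ∑ j, v j = 0 := by simpa using hrow (Fin.last u)
      have hsmall (i : Fin (u + 1)) (hi : (i : ℕ) < u) : v i = 0 := by
        have := hrow i
        rw [hsum, if_pos hi] at this
        linarith
      refine hv (funext fun i => ?_)
      rcases Nat.lt_or_ge i u with hi | hi
      · exact hsmall i hi
      · rw [Finset.sum_eq_single i] at hsum
        · exact hsum
        · intro j _ hj
          exact hsmall j (by have := Fin.val_ne_of_ne hj; omega)
        · simp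
    have hsub : (Dmat n u).submatrix (Fin.castLE hu) (Fin.castLE hu) = Dmat (u + 1) u := by
      ext i j
      simp [Dmat]
    rw [← Fintype.card_fin (u + 1), ← rank_of_det_ne_zero hdet, ← hsub]
    exact rank_submatrix_le _ _ _

/-- Deleting two columns `s`, `t` lowers the rank by at most two, and by at most one unless both
belong to a small set of coloops. -/
theorem exists_coloops {m l : ℕ} (R : Matrix (Fin m) (Fin (m + 2)) ℚ) (hm : 1 ≤ m)
    (hR : ∀ i j, R i j ≠ 0) (hl : l ≤ R.rank) (hl1 : 1 ≤ l) :
    ∃ Z : Finset (Fin (m + 2)), Z.card + 1 ≤ l ∧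
      ∀ (s t : Fin (m + 2)) (κ : Fin m → Fin (m + 2)),
        (∀ x, x ≠ s → x ≠ t → x ∈ Set.range κ) →
        l ≤ (R.submatrix id κ).rank + 1 ∨
          s ∈ Z ∧ t ∈ Z ∧ l ≤ (R.submatrix id κ).rank + 2 := by
  classical
  let V : Submodule ℚ (Fin (m + 2) → ℚ) := Submodule.span ℚ (Set.range R.row)
  have hV : R.rank = Module.finrank ℚ V := R.rank_eq_finrank_span_row
  have drop (s t : Fin (m + 2)) (κ : Fin m → Fin (m + 2))
      (hκ : ∀ x, x ≠ s → x ≠ t → x ∈ Set.range κ) :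
      R.rank ≤ (R.submatrix id κ).rank + 2 ∧
        (Pi.single s 1 ∉ V ∨ Pi.single t 1 ∉ V → R.rank ≤ (R.submatrix id κ).rank + 1) := by
    let φ : V →ₗ[ℚ] (Fin m → ℚ) := (LinearMap.funLeft ℚ ℚ κ).domRestrict V
    have hφ : Module.finrank ℚ (LinearMap.range φ) = (R.submatrix id κ).rank := by
      have : LinearMap.range φ = Submodule.span ℚ (Set.range (R.submatrix id κ).row) := by
        rw [LinearMap.range_domRestrict, Submodule.map_span, ← Set.range_comp]
        rfl
      rw [rank_eq_finrank_span_row, this]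
    have hrn := φ.finrank_range_add_finrank_ker
    rw [hφ, ← hV] at hrn
    have hker (x : LinearMap.ker φ) (y) (hs : y ≠ s) (ht : y ≠ t) :
        (x.1.1 : Fin (m + 2) → ℚ) y = 0 := by
      obtain ⟨i, rfl⟩ := hκ y hs ht
      exact congrFun (LinearMap.mem_ker.1 x.2) i
    let ev (c : Fin (m + 2)) : LinearMap.ker φ →ₗ[ℚ] ℚ :=
      (LinearMap.proj c).comp (V.subtype.comp (LinearMap.ker φ).subtype)
    have hev (c) (x) : ev c x = (x.1.1 : Fin (m + 2) → ℚ) c := rfl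
    have one (c d : Fin (m + 2)) (hcd : ∀ y, y ≠ c → y ≠ d → y ≠ s ∧ y ≠ t)
        (hc : Pi.single c 1 ∉ V) : Module.finrank ℚ (LinearMap.ker φ) ≤ 1 := by
      suffices hinj : Function.Injective (ev d) by
        have h := LinearMap.finrank_le_finrank_of_injective hinj
        rwa [Module.finrank_self] at h
      refine (injective_iff_map_eq_zero _).2 fun x hx => ?_
      by_contra hne
      have hx' : (x.1.1 : Fin (m + 2) → ℚ) = (x.1.1 c) • Pi.single c 1 := by
        ext y
        by_cases hyc : y = c
        · subst hyc; simp
        by_cases hyd : y = d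
        · subst hyd; rw [← hev, hx]; simp [hyc]
        · rw [hker x y (hcd y hyc hyd).1 (hcd y hyc hyd).2]; simp [hyc]
      by_cases h0 : x.1.1 c = 0
      · rw [h0, zero_smul] at hx'
        exact hne (Subtype.ext (Subtype.ext hx'))
      · refine hc ?_
        rw [← Submodule.smul_mem_iff _ h0, ← hx']
        exact x.1.2
    have two : Module.finrank ℚ (LinearMap.ker φ) ≤ 2 := by
      suffices hinj : Function.Injective ((ev s).prod (ev t)) by
        have h := LinearMap.finrank_le_finrank_of_injective hinj
        simpa using h
      refine (injective_iff_map_eq_zero _).2 fun x hx => ?_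
      refine Subtype.ext (Subtype.ext (funext fun y => ?_))
      have h1 : x.1.1 s = 0 := congrArg Prod.fst hx
      have h2 : x.1.1 t = 0 := congrArg Prod.snd hx
      by_cases hs : y = s
      · rw [hs, h1]; rfl
      by_cases ht : y = t
      · rw [ht, h2]; rfl
      · rw [hker x y hs ht]; rfl
    refine ⟨by omega, ?_⟩
    rintro (h | h)
    · have := one s t (fun y h1 h2 => ⟨h1, h2⟩) h
      omega
    · have := one t s (fun y h1 h2 => ⟨h2, h1⟩) h
      omega
  rcases hl.lt_or_eq with hlt | heq
  · refine ⟨∅, by simpa using hl1, fun s t κ hκ => .inl ?_⟩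
    have := (drop s t κ hκ).1
    omega
  · refine ⟨Finset.univ.filter fun s => Pi.single s 1 ∈ V, ?_, fun s t κ hκ => ?_⟩
    · set Z : Finset (Fin (m + 2)) := Finset.univ.filter fun s => Pi.single s 1 ∈ V with hZ
      have hZmem (z) (hz : z ∈ Z) : Pi.single z 1 ∈ V := (Finset.mem_filter.1 hz).2
      have hrow : R.row ⟨0, hm⟩ ∈ V := Submodule.subset_span ⟨_, rfl⟩
      have hcomb (a : Fin (m + 2) → ℚ) : ∑ z ∈ Z, a z • Pi.single z (1 : ℚ) ∈ V :=
        Submodule.sum_mem _ fun z hz => Submodule.smul_mem _ _ (hZmem z hz)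
      have happ (a : Fin (m + 2) → ℚ) (y) :
          (∑ z ∈ Z, a z • Pi.single z (1 : ℚ) : Fin (m + 2) → ℚ) y = if y ∈ Z then a y else 0 := by
        simp [Finset.sum_apply, Pi.single_apply]
      let π : V →ₗ[ℚ] (Z → ℚ) := (LinearMap.funLeft ℚ ℚ (Subtype.val)).domRestrict V
      have hsurj : Function.Surjective π := by
        intro a
        refine ⟨⟨_, hcomb fun y => if h : y ∈ Z then a ⟨y, h⟩ else 0⟩, ?_⟩
        ext y
        exact (happ _ y.1).trans (by simp)
      have hrn := π.finrank_range_add_finrank_ker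
      rw [LinearMap.range_eq_top.2 hsurj, finrank_top, Module.finrank_fintype_fun_eq_card,
        Fintype.card_coe, ← hV, ← heq] at hrn
      obtain ⟨y, hy⟩ : ∃ y, y ∉ Z := by
        by_contra! hall
        have h1 := Finset.card_le_card (fun y _ => hall y : Finset.univ ⊆ Z)
        have h2 := R.rank_le_height
        simp only [Finset.card_univ, Fintype.card_fin] at h1
        omega
      have hpos : 0 < Module.finrank ℚ (LinearMap.ker π) := by
        rw [pos_iff_ne_zero]
        intro h0
        suffices h : ∃ x : LinearMap.ker π, x ≠ 0 by
          obtain ⟨x, hx⟩ := h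
          exact hx (Subtype.ext ((Submodule.mem_bot ℚ).1 (Submodule.finrank_eq_zero.1 h0 ▸ x.2)))
        refine ⟨⟨⟨R.row ⟨0, hm⟩ - _, V.sub_mem hrow (hcomb (R.row ⟨0, hm⟩))⟩, ?_⟩, ?_⟩
        · rw [LinearMap.mem_ker]
          ext z
          exact sub_eq_zero.2 ((happ (R.row ⟨0, hm⟩) z.1).trans (if_pos z.2)).symm
        · intro h
          have h' := congrFun (congrArg (fun x => (x.1.1 : Fin (m + 2) → ℚ)) h) y
          exact hR _ _ ((sub_eq_zero.1 h').trans ((happ (R.row ⟨0, hm⟩) y).trans (if_neg hy)))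
      omega
    · have h := drop s t κ hκ
      by_cases hs : Pi.single s 1 ∈ V
      · by_cases ht : Pi.single t 1 ∈ V
        · exact .inr ⟨by simpa using hs, by simpa using ht, by omega⟩
        · have := h.2 (.inr ht)
          omega
      · have := h.2 (.inl hs)
        omega

theorem per_two_rows {m : ℕ} (A : Matrix (Fin (m + 2)) (Fin (m + 2)) ℚ) :
    per A = ∑ p : Fin (m + 2) × Fin (m + 1), A 0 p.1 * A 1 (p.1.succAbove p.2) *
      per (A.submatrix (Fin.succ ∘ Fin.succ) (p.1.succAbove ∘ p.2.succAbove)) := by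
  rw [per_laplace A 0, Fintype.sum_prod_type]
  refine Finset.sum_congr rfl fun s _ => ?_
  rw [per_laplace _ 0, Finset.mul_sum]
  refine Finset.sum_congr rfl fun t _ => ?_
  rw [mul_assoc]
  rfl

/-- Averaging the expansion along two `±1` rows over their exchange kills the pairs of columns on
which exactly one of the columns agrees in the two rows. -/
theorem abs_per_le_two_rows {m : ℕ} (A : Matrix (Fin (m + 2)) (Fin (m + 2)) ℚ)
    (hA : ∀ i j, A i j = 1 ∨ A i j = -1) :
    |per A| ≤ ∑ p : Fin (m + 2) × Fin (m + 1),
      if (A 0 p.1 = A 1 p.1 ↔ A 0 (p.1.succAbove p.2) = A 1 (p.1.succAbove p.2)) then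
        |per (A.submatrix (Fin.succ ∘ Fin.succ) (p.1.succAbove ∘ p.2.succAbove))| else 0 := by
  have hswap : per A = ∑ p : Fin (m + 2) × Fin (m + 1), A 1 p.1 * A 0 (p.1.succAbove p.2) *
      per (A.submatrix (Fin.succ ∘ Fin.succ) (p.1.succAbove ∘ p.2.succAbove)) := by
    rw [← per_submatrix A (Equiv.swap 0 1) 1, per_two_rows]
    refine Finset.sum_congr rfl fun p _ => ?_
    have hsub : (A.submatrix (Equiv.swap (0 : Fin (m + 2)) 1) (1 : Equiv.Perm (Fin (m + 2)))).submatrix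
        (Fin.succ ∘ Fin.succ) (p.1.succAbove ∘ p.2.succAbove) =
        A.submatrix (Fin.succ ∘ Fin.succ) (p.1.succAbove ∘ p.2.succAbove) := by
      ext i j
      simp only [submatrix_apply, Function.comp_apply]
      rw [Equiv.swap_apply_of_ne_of_ne, Equiv.Perm.one_apply]
      · exact Fin.succ_ne_zero _
      · exact fun h => Fin.succ_ne_zero i (Fin.succ_injective _ h)
    rw [hsub]
    simp
  have h2 : per A = ∑ p : Fin (m + 2) × Fin (m + 1),
      (A 0 p.1 * A 1 (p.1.succAbove p.2) + A 1 p.1 * A 0 (p.1.succAbove p.2)) / 2 *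
        per (A.submatrix (Fin.succ ∘ Fin.succ) (p.1.succAbove ∘ p.2.succAbove)) := by
    have h1 := per_two_rows A
    rw [← add_self_div_two (per A)]
    nth_rewrite 1 [h1]
    nth_rewrite 1 [hswap]
    rw [← Finset.sum_add_distrib, Finset.sum_div]
    refine Finset.sum_congr rfl fun p _ => ?_
    ring
  rw [h2]
  refine (Finset.abs_sum_le_sum_abs _ _).trans (Finset.sum_le_sum fun p _ => ?_)
  rw [abs_mul]
  rcases hA 0 p.1 with h | h <;> rcases hA 1 p.1 with h' | h' <;>
    rcases hA 0 (p.1.succAbove p.2) with k | k <;> rcases hA 1 (p.1.succAbove p.2) with k' | k' <;>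
    rw [h, h', k, k'] <;> norm_num

theorem sum_pairs {m : ℕ} (f : Fin (m + 2) → Fin (m + 2) → ℚ) :
    ∑ p : Fin (m + 2) × Fin (m + 1), f p.1 (p.1.succAbove p.2) =
      ∑ s, ∑ t, f s t - ∑ s, f s s := by
  rw [Fintype.sum_prod_type, ← Finset.sum_sub_distrib]
  refine Finset.sum_congr rfl fun s _ => ?_
  rw [Fin.sum_univ_succAbove _ s]
  ring

theorem sum_pairs_mem {m : ℕ} (Z : Finset (Fin (m + 2))) :
    ∑ p : Fin (m + 2) × Fin (m + 1), (if p.1 ∈ Z ∧ p.1.succAbove p.2 ∈ Z then (1 : ℚ) else 0) =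
      Z.card * (Z.card - 1) := by
  have h := sum_pairs fun s t => (if s ∈ Z then (1 : ℚ) else 0) * (if t ∈ Z then 1 else 0)
  simp only [← Finset.mul_sum, ← Finset.sum_mul] at h
  simp only [ite_zero_mul_ite_zero, mul_one, and_self, Finset.sum_boole, Finset.filter_mem_eq_inter,
    Finset.univ_inter] at h
  rw [Finset.sum_boole, h]
  ring

theorem sum_pairs_same_le {m : ℕ} (c : Fin (m + 2) → Prop) [DecidablePred c]
    (hc : 2 ≤ (Finset.univ.filter c).card) (hc' : 2 ≤ (Finset.univ.filter fun j => ¬ c j).card) :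
    ∑ p : Fin (m + 2) × Fin (m + 1), (if (c p.1 ↔ c (p.1.succAbove p.2)) then (1 : ℚ) else 0) ≤
      m * (m - 1) + 2 := by
  have h1 := sum_pairs_mem (Finset.univ.filter c)
  have h2 := sum_pairs_mem (Finset.univ.filter fun j => ¬ c j)
  have hcard := Finset.card_filter_add_card_filter_not (s := (Finset.univ : Finset (Fin (m + 2)))) c
  have hsplit : ∑ p : Fin (m + 2) × Fin (m + 1),
      (if (c p.1 ↔ c (p.1.succAbove p.2)) then (1 : ℚ) else 0) =
      ((Finset.univ.filter c).card : ℚ) * ((Finset.univ.filter c).card - 1) +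
        ((Finset.univ.filter fun j => ¬ c j).card : ℚ) *
          ((Finset.univ.filter fun j => ¬ c j).card - 1) := by
    rw [← h1, ← h2, ← Finset.sum_add_distrib]
    refine Finset.sum_congr rfl fun p _ => ?_
    by_cases h : c p.1 <;> by_cases h' : c (p.1.succAbove p.2) <;> simp [h, h']
  rw [hsplit]
  rw [Finset.card_univ, Fintype.card_fin] at hcard
  have hp : (2 : ℚ) ≤ (Finset.univ.filter c).card := by exact_mod_cast hc
  have hq : (2 : ℚ) ≤ (Finset.univ.filter fun j => ¬ c j).card := by exact_mod_cast hc'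
  have hpq : ((Finset.univ.filter c).card : ℚ) + (Finset.univ.filter fun j => ¬ c j).card =
      m + 2 := by exact_mod_cast hcard
  rw [show (m : ℚ) = _ from eq_sub_of_add_eq hpq.symm]
  nlinarith [mul_nonneg (sub_nonneg.2 hp) (sub_nonneg.2 hq)]

theorem exists_minor_ne_zero {m n : ℕ} (R : Matrix (Fin m) (Fin n) ℚ) (hR : ∀ i j, R i j ≠ 0)
    (hrk : 2 ≤ R.rank) :
    ∃ i i' j j', R i j * R i' j' ≠ R i j' * R i' j := by
  by_contra! h
  have hm : 0 < m := by have := R.rank_le_height; omega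
  have hn : 0 < n := by have := R.rank_le_width; omega
  have : R = vecMulVec (fun i => R i ⟨0, hn⟩ / R ⟨0, hm⟩ ⟨0, hn⟩) (fun j => R ⟨0, hm⟩ j) := by
    ext i j
    have := h i ⟨0, hm⟩ j ⟨0, hn⟩
    rw [vecMulVec_apply, div_mul_eq_mul_div, eq_div_iff (hR _ _), this]
  have hvec := rank_vecMulVec_le (fun i => R i ⟨0, hn⟩ / R ⟨0, hm⟩ ⟨0, hn⟩) (fun j => R ⟨0, hm⟩ j)
  rw [← this] at hvec
  omega

theorem two_le_rank_of_minor {m n : ℕ} (R : Matrix (Fin m) (Fin n) ℚ) {i i' : Fin m} {j j' : Fin n}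
    (h : R i j * R i' j' ≠ R i j' * R i' j) : 2 ≤ R.rank := by
  have hdet : (R.submatrix (![i, i'] : Fin 2 → Fin m) (![j, j'] : Fin 2 → Fin n)).det ≠ 0 := by
    rw [det_fin_two]
    simpa [sub_eq_zero] using h
  have := rank_submatrix_le R (![i, i'] : Fin 2 → Fin m) (![j, j'] : Fin 2 → Fin n)
  rw [rank_of_det_ne_zero hdet] at this
  simpa using this

theorem per_fin_four (A : Matrix (Fin 4) (Fin 4) ℚ) :
    per A =
      (A 0 0 * A 1 1 + A 0 1 * A 1 0) * (A 2 2 * A 3 3 + A 2 3 * A 3 2) +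
      (A 0 0 * A 1 2 + A 0 2 * A 1 0) * (A 2 1 * A 3 3 + A 2 3 * A 3 1) +
      (A 0 0 * A 1 3 + A 0 3 * A 1 0) * (A 2 1 * A 3 2 + A 2 2 * A 3 1) +
      (A 0 1 * A 1 2 + A 0 2 * A 1 1) * (A 2 0 * A 3 3 + A 2 3 * A 3 0) +
      (A 0 1 * A 1 3 + A 0 3 * A 1 1) * (A 2 0 * A 3 2 + A 2 2 * A 3 0) +
      (A 0 2 * A 1 3 + A 0 3 * A 1 2) * (A 2 0 * A 3 1 + A 2 1 * A 3 0) := by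
  have h2 (B : Matrix (Fin 2) (Fin 2) ℚ) : per B = B 0 0 * B 1 1 + B 0 1 * B 1 0 := by
    rw [per_laplace B 0]
    simp [per, Fin.sum_univ_succ]
  have h3 (B : Matrix (Fin 3) (Fin 3) ℚ) : per B = B 0 0 * (B 1 1 * B 2 2 + B 1 2 * B 2 1) +
      B 0 1 * (B 1 0 * B 2 2 + B 1 2 * B 2 0) + B 0 2 * (B 1 0 * B 2 1 + B 1 1 * B 2 0) := by
    rw [per_laplace B 0]
    refine (Fin.sum_univ_three _).trans ?_
    simp only [h2]
    rfl
  rw [per_laplace A 0]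
  refine (Fin.sum_univ_four _).trans ?_
  simp only [h3]
  change A 0 0 * (A 1 1 * (A 2 2 * A 3 3 + A 2 3 * A 3 2) +
      A 1 2 * (A 2 1 * A 3 3 + A 2 3 * A 3 1) + A 1 3 * (A 2 1 * A 3 2 + A 2 2 * A 3 1)) +
    A 0 1 * (A 1 0 * (A 2 2 * A 3 3 + A 2 3 * A 3 2) +
      A 1 2 * (A 2 0 * A 3 3 + A 2 3 * A 3 0) + A 1 3 * (A 2 0 * A 3 2 + A 2 2 * A 3 0)) +
    A 0 2 * (A 1 0 * (A 2 1 * A 3 3 + A 2 3 * A 3 1) +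
      A 1 1 * (A 2 0 * A 3 3 + A 2 3 * A 3 0) + A 1 3 * (A 2 0 * A 3 1 + A 2 1 * A 3 0)) +
    A 0 3 * (A 1 0 * (A 2 1 * A 3 2 + A 2 2 * A 3 1) +
      A 1 1 * (A 2 0 * A 3 2 + A 2 2 * A 3 0) + A 1 2 * (A 2 0 * A 3 1 + A 2 1 * A 3 0)) = _
  ring

/-- The integer sign of a boolean. -/
def boolSign (b : Bool) : ℤ := if b then -1 else 1

theorem exists_boolSign {q : ℚ} (h : q = 1 ∨ q = -1) : ∃ b, q = (boolSign b : ℤ) := by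
  rcases h with rfl | rfl
  · exact ⟨false, by simp [boolSign]⟩
  · exact ⟨true, by simp [boolSign]⟩

set_option synthInstance.maxSize 1000 in
set_option synthInstance.maxHeartbeats 200000 in
theorem four_sign_rows : ∀ v₁ v₂ v₃ : Bool,
    1 + boolSign v₁ + boolSign v₂ + boolSign v₃ = 0 → ∀ x₁ x₂ x₃ y₁ y₂ y₃ : Bool,
    ((boolSign v₁ + 1) * (boolSign x₂ * boolSign y₃ + boolSign x₃ * boolSign y₂) +
      (boolSign v₂ + 1) * (boolSign x₁ * boolSign y₃ + boolSign x₃ * boolSign y₁) +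
      (boolSign v₃ + 1) * (boolSign x₁ * boolSign y₂ + boolSign x₂ * boolSign y₁) +
      (boolSign v₂ + boolSign v₁) * (boolSign y₃ + boolSign x₃) +
      (boolSign v₃ + boolSign v₁) * (boolSign y₂ + boolSign x₂) +
      (boolSign v₃ + boolSign v₂) * (boolSign y₁ + boolSign x₁)).natAbs = 8 →
    ¬ (x₁ = y₁ ∧ x₂ = y₂ ∧ x₃ = y₃) →
    (1 + boolSign x₁ + boolSign x₂ + boolSign x₃ = 0 ∧
      1 + boolSign y₁ + boolSign y₂ + boolSign y₃ = 0 ∧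
      1 + boolSign v₁ * boolSign x₁ + boolSign v₂ * boolSign x₂ + boolSign v₃ * boolSign x₃ = 0 ∧
      1 + boolSign v₁ * boolSign y₁ + boolSign v₂ * boolSign y₂ + boolSign v₃ * boolSign y₃ = 0 ∧
      1 + boolSign x₁ * boolSign y₁ + boolSign x₂ * boolSign y₂ + boolSign x₃ * boolSign y₃ = 0) ∨
    ((¬ x₁ ∧ ¬ x₂ ∧ ¬ x₃ ∨ x₁ = v₁ ∧ x₂ = v₂ ∧ x₃ = v₃) ∧
      (¬ y₁ ∧ ¬ y₂ ∧ ¬ y₃ ∨ y₁ = v₁ ∧ y₂ = v₂ ∧ y₃ = v₃)) := by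
  decide +kernel

theorem rank_ne_three_of_four {A : Matrix (Fin 4) (Fin 4) ℚ} (hA : ∀ i j, A i j = 1 ∨ A i j = -1)
    (horth : ∑ j, A 0 j * A 1 j = 0)
    (hR : 2 ≤ (A.submatrix ![2, 3] id).rank) (hper : |per A| = 8) : A.rank ≠ 3 := by
  have hsq (i j) : A i j * A i j = 1 := by rcases hA i j with h | h <;> rw [h] <;> norm_num
  have hmul {x y : ℚ} (hx : x = 1 ∨ x = -1) (hy : y = 1 ∨ y = -1) : x * y = 1 ∨ x * y = -1 := by
    rcases hx with rfl | rfl <;> rcases hy with rfl | rfl <;> norm_num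
  let ε (i : Fin 4) : ℚ := A i 0 * A 0 0
  let δ (j : Fin 4) : ℚ := A 0 j
  let C : Matrix (Fin 4) (Fin 4) ℚ := of fun i j => ε i * δ j * A i j
  have hε (i) : ε i = 1 ∨ ε i = -1 := hmul (hA _ _) (hA _ _)
  have hC (i j) : C i j = 1 ∨ C i j = -1 := hmul (hmul (hε i) (hA 0 j)) (hA i j)
  have hεε (i) : ε i * ε i = 1 := by rcases hε i with h | h <;> rw [h] <;> norm_num
  have hAC (i j) : A i j = ε i * δ j * C i j := by
    change A i j = ε i * A 0 j * (ε i * A 0 j * A i j)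
    linear_combination (-A i j * ε i * ε i) * hsq 0 j - A i j * hεε i
  have hstd : StdEquiv A C := ⟨1, 1, ε, δ, hε, hA 0, .inl hAC⟩
  rw [hstd.rank_eq]
  rw [hstd.abs_per] at hper
  have hC0 (j) : C 0 j = 1 := by
    change A 0 0 * A 0 0 * A 0 j * A 0 j = 1
    rw [hsq, one_mul, hsq]
  have hC1 (i) : C i 0 = 1 := by
    change A i 0 * A 0 0 * A 0 0 * A i 0 = 1
    rw [mul_assoc (A i 0), hsq, mul_one, hsq]
  have horthC : ∑ j, C 1 j = 0 := by
    have : ∑ j, C 1 j = ε 1 * ∑ j, A 0 j * A 1 j := by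
      rw [Finset.mul_sum]
      exact Finset.sum_congr rfl fun j _ => mul_assoc _ _ _
    rw [this, horth, mul_zero]
  choose b hb using fun i j => exists_boolSign (hC i j)
  have hinj (i i' j) : b i j = b i' j → C i j = C i' j := fun h => by rw [hb, hb i', h]
  have key := four_sign_rows (b 1 1) (b 1 2) (b 1 3)
    (by
      rw [Fin.sum_univ_four, hC1, hb 1 1, hb 1 2, hb 1 3] at horthC
      exact_mod_cast horthC)
    (b 2 1) (b 2 2) (b 2 3) (b 3 1) (b 3 2) (b 3 3)
    (by
      rw [per_fin_four] at hper
      simp only [hC0, hC1, one_mul, mul_one] at hper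
      simp only [hb] at hper
      have h8 : ((8 : ℕ) : ℤ) = 8 := rfl
      rw [← Int.natCast_inj, Int.natCast_natAbs, h8]
      exact_mod_cast hper)
    (by
      rintro ⟨h1, h2, h3⟩
      have hrow (j) : C 2 j = C 3 j := by
        fin_cases j
        · exact (hC1 2).trans (hC1 3).symm
        · exact hinj _ _ _ h1
        · exact hinj _ _ _ h2
        · exact hinj _ _ _ h3
      obtain ⟨i, i', j, j', h⟩ := exists_minor_ne_zero (A.submatrix ![2, 3] id)
        (fun i j h => by rcases hA (![2, 3] i) j with h' | h' <;> simp_all) hR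
      have hrow' (i : Fin 2) (j) : C (![2, 3] i) j = C 3 j := by
        fin_cases i
        · exact hrow j
        · rfl
      refine h ?_
      simp only [submatrix_apply, id]
      rw [hAC, hAC _ j', hAC _ j', hAC _ j]
      simp only [hrow']
      ring)
  rcases key with ⟨h02, h03, h12, h13, h23⟩ | ⟨hx, hy⟩
  · have hq {z : ℤ} (hz : z = 0) : (z : ℚ) = 0 := by rw [hz, Int.cast_zero]
    have hCC : C * Cᵀ = diagonal fun _ => 4 := by
      have hCsq (i j) : C i j * C i j = 1 := by rcases hC i j with h | h <;> rw [h] <;> norm_num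
      have e (i i' : Fin 4) : (C * Cᵀ) i i' = C i 0 * C i' 0 + C i 1 * C i' 1 + C i 2 * C i' 2 +
          C i 3 * C i' 3 := by
        rw [mul_apply, Fin.sum_univ_four]
        rfl
      have hdiag (i) : (C * Cᵀ) i i = 4 := by rw [e]; simp only [hCsq]; norm_num
      have hsymm (i i') (h : (C * Cᵀ) i i' = 0) : (C * Cᵀ) i' i = 0 := by
        rw [e] at h ⊢
        linarith
      have g01 : (C * Cᵀ) 0 1 = 0 := by
        rw [e]
        simp only [hC0, one_mul]
        rw [← horthC, Fin.sum_univ_four]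
      have g02 : (C * Cᵀ) 0 2 = 0 := by
        rw [e]
        simp only [hC0, hC1, one_mul, mul_one]
        simp only [hb]
        exact_mod_cast hq h02
      have g03 : (C * Cᵀ) 0 3 = 0 := by
        rw [e]
        simp only [hC0, hC1, one_mul, mul_one]
        simp only [hb]
        exact_mod_cast hq h03
      have g12 : (C * Cᵀ) 1 2 = 0 := by
        rw [e]
        simp only [hC1, mul_one]
        simp only [hb]
        exact_mod_cast hq h12
      have g13 : (C * Cᵀ) 1 3 = 0 := by
        rw [e]
        simp only [hC1, mul_one]
        simp only [hb]
        exact_mod_cast hq h13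
      have g23 : (C * Cᵀ) 2 3 = 0 := by
        rw [e]
        simp only [hC1, mul_one]
        simp only [hb]
        exact_mod_cast hq h23
      ext i i'
      by_cases hii : i = i'
      · subst hii
        rw [hdiag, diagonal_apply_eq]
      · rw [diagonal_apply_ne _ hii]
        fin_cases i <;> fin_cases i' <;>
          first
          | exact absurd rfl hii
          | assumption
          | (apply hsymm; assumption)
    have hdet : C.det ≠ 0 := by
      intro h
      have := congrArg det hCC
      rw [det_mul, h, zero_mul, det_diagonal] at this
      norm_num at this
    rw [rank_of_det_ne_zero hdet]
    decide
  · have row (i : Fin 4) : ∃ k : Fin 2, ∀ j, C i j = C (![0, 1] k) j := by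
      have zero {a : Bool} (ha : ¬ a) : (boolSign a : ℚ) = 1 := by simp [boolSign, ha]
      have aux (i) (h : ¬ b i 1 ∧ ¬ b i 2 ∧ ¬ b i 3 ∨
          b i 1 = b 1 1 ∧ b i 2 = b 1 2 ∧ b i 3 = b 1 3) :
          ∃ k : Fin 2, ∀ j, C i j = C (![0, 1] k) j := by
        rcases h with ⟨h1, h2, h3⟩ | ⟨h1, h2, h3⟩
        · refine ⟨0, fun j => ?_⟩
          change C i j = C 0 j
          rw [hC0]
          fin_cases j
          · exact hC1 i
          · exact (hb i 1).trans (zero h1)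
          · exact (hb i 2).trans (zero h2)
          · exact (hb i 3).trans (zero h3)
        · refine ⟨1, fun j => ?_⟩
          fin_cases j
          · exact (hC1 i).trans (hC1 1).symm
          · exact hinj _ _ _ h1
          · exact hinj _ _ _ h2
          · exact hinj _ _ _ h3
      fin_cases i
      · exact ⟨0, fun j => rfl⟩
      · exact ⟨1, fun j => rfl⟩
      · exact aux 2 hx
      · exact aux 3 hy
    choose k hk using row
    have hCk : C = (C.submatrix ![0, 1] id).submatrix k id := by
      ext i j
      exact hk i j
    have h1 := rank_submatrix_le (C.submatrix (![0, 1] : Fin 2 → Fin 4) id) k id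
    rw [← hCk] at h1
    have h2 := rank_le_height (C.submatrix (![0, 1] : Fin 2 → Fin 4) id)
    omega

/-- The bound for permanents of size `m` in terms of the rank, singular or not. -/
def PerRankBound (m : ℕ) : Prop :=
  ∀ (l : ℕ) (B : Matrix (Fin m) (Fin m) ℚ), (∀ i j, B i j = 1 ∨ B i j = -1) →
    l + 2 ≤ m → l + 1 ≤ B.rank → |per B| ≤ perD (m - l) l

theorem abs_per_lt_of_far {m l : ℕ} (hW : PerRankBound m)
    {A : Matrix (Fin (m + 2)) (Fin (m + 2)) ℚ} (hA : ∀ i j, A i j = 1 ∨ A i j = -1)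
    (heq : 2 ≤ (Finset.univ.filter fun j => A 0 j = A 1 j).card)
    (hne : 2 ≤ (Finset.univ.filter fun j => ¬ A 0 j = A 1 j).card)
    (hl3 : 3 ≤ l) (hlm : l ≤ m) (hR : l ≤ (A.submatrix (Fin.succ ∘ Fin.succ) id).rank) :
    |per A| < perD (m + 2 - l) l := by
  obtain ⟨j, rfl⟩ := Nat.exists_eq_add_of_le' hl3
  obtain ⟨a, rfl⟩ : ∃ a, m = a + j + 1 := ⟨m - j - 1, by omega⟩
  have ha : 2 ≤ a := by omega
  rw [show a + j + 1 + 2 - (j + 3) = a by omega]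
  have hne0 (i j) : A i j ≠ 0 := by rcases hA i j with h | h <;> rw [h] <;> norm_num
  obtain ⟨Z, hZ, hcol⟩ := exists_coloops (A.submatrix (Fin.succ ∘ Fin.succ) id) (by omega)
    (fun i j => hne0 _ _) hR (by omega)
  have hpos := perD_nonneg a j (by omega)
  have hbound (p : Fin (a + j + 1 + 2) × Fin (a + j + 1 + 1)) :
      (if (A 0 p.1 = A 1 p.1 ↔ A 0 (p.1.succAbove p.2) = A 1 (p.1.succAbove p.2)) then
        |per (A.submatrix (Fin.succ ∘ Fin.succ) (p.1.succAbove ∘ p.2.succAbove))| else 0) ≤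
      (perD a (j + 1) : ℚ) *
        (if (A 0 p.1 = A 1 p.1 ↔ A 0 (p.1.succAbove p.2) = A 1 (p.1.succAbove p.2)) then 1 else 0) +
      2 * (perD a j : ℚ) * (if p.1 ∈ Z ∧ p.1.succAbove p.2 ∈ Z then 1 else 0) := by
    have hpos' : (0 : ℚ) ≤ 2 * (perD a j : ℚ) := by exact_mod_cast (by omega : 0 ≤ 2 * perD a j)
    have hnn : (0 : ℚ) ≤ if p.1 ∈ Z ∧ p.1.succAbove p.2 ∈ Z then 1 else 0 := by
      split_ifs <;> norm_num
    by_cases hs : (A 0 p.1 = A 1 p.1 ↔ A 0 (p.1.succAbove p.2) = A 1 (p.1.succAbove p.2))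
    · rw [if_pos hs, if_pos hs, mul_one]
      rcases hcol p.1 (p.1.succAbove p.2) (p.1.succAbove ∘ p.2.succAbove) (fun x h1 h2 => by
          obtain ⟨y, rfl⟩ := Fin.exists_succAbove_eq h1
          obtain ⟨z, rfl⟩ := Fin.exists_succAbove_eq
            (fun h => h2 (congrArg p.1.succAbove h) : y ≠ p.2)
          exact ⟨z, rfl⟩) with h | ⟨hz, hz', h⟩
      · have := hW (j + 1) _ (fun i k => hA _ _) (by omega)
          (Nat.le_of_succ_le_succ h : j + 1 + 1 ≤ (A.submatrix (Fin.succ ∘ Fin.succ)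
            (p.1.succAbove ∘ p.2.succAbove)).rank)
        rw [show a + j + 1 - (j + 1) = a by omega] at this
        exact this.trans (le_add_of_nonneg_right (mul_nonneg hpos' hnn))
      · have := hW j _ (fun i k => hA _ _) (by omega)
          (by simpa using h : j + 1 ≤ (A.submatrix (Fin.succ ∘ Fin.succ)
            (p.1.succAbove ∘ p.2.succAbove)).rank)
        rw [show a + j + 1 - j = a + 1 by omega] at this
        rw [if_pos ⟨hz, hz'⟩, mul_one]
        refine this.trans (le_of_eq ?_)
        rw [perD_succ]
        push_cast
        ring
    · rw [if_neg hs, if_neg hs, mul_zero, zero_add]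
      exact mul_nonneg hpos' hnn
  have hsame := sum_pairs_same_le _ heq hne
  have hmem := sum_pairs_mem Z
  have hZ' : (Z.card : ℚ) * (Z.card - 1) ≤ (j + 2) * (j + 1) := by
    have h1 : (Z.card : ℚ) ≤ j + 2 := by exact_mod_cast (by omega : Z.card ≤ j + 2)
    have h0 : (0 : ℚ) ≤ Z.card := by positivity
    have hj : (0 : ℚ) ≤ j := by positivity
    nlinarith [mul_nonneg (sub_nonneg.2 h1) (add_nonneg h0 hj)]
  have hlt : (((a + j + 1) * (a + j) + 2) * perD a (j + 1) +
      2 * ((j + 2) * (j + 1)) * perD a j : ℚ) < perD a (j + 3) := by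
    exact_mod_cast perD_two_row_lt a j ha
  refine lt_of_le_of_lt ((abs_per_le_two_rows A hA).trans
    ((Finset.sum_le_sum fun p _ => hbound p).trans ?_)) hlt
  rw [Finset.sum_add_distrib, ← Finset.mul_sum, ← Finset.mul_sum, hmem]
  push_cast at hsame
  have h0 : (0 : ℚ) ≤ perD a j := by exact_mod_cast hpos
  have h1 : (0 : ℚ) ≤ perD a (j + 1) := by exact_mod_cast perD_nonneg a (j + 1) (by omega)
  have e1 := mul_le_mul_of_nonneg_left hsame h1
  have e2 := mul_le_mul_of_nonneg_left hZ' (mul_nonneg zero_le_two h0)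
  linarith

theorem perD_two (a : ℕ) : perD a 2 = (a * (a - 1) + 2) * a.factorial := by
  rw [perD_succ, perD_succ, perD_succ, perD_zero, perD_zero, perD_zero, Nat.factorial_succ (a + 1),
    Nat.factorial_succ a]
  push_cast
  ring

theorem abs_per_le_of_far {m : ℕ}
    {A : Matrix (Fin (m + 2)) (Fin (m + 2)) ℚ} (hA : ∀ i j, A i j = 1 ∨ A i j = -1)
    (heq : 2 ≤ (Finset.univ.filter fun j => A 0 j = A 1 j).card)
    (hne : 2 ≤ (Finset.univ.filter fun j => ¬ A 0 j = A 1 j).card) :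
    |per A| ≤ perD m 2 ∧ ((∃ p : Fin (m + 2) × Fin (m + 1), (A 0 p.1 = A 1 p.1 ↔
      A 0 (p.1.succAbove p.2) = A 1 (p.1.succAbove p.2)) ∧
      |per (A.submatrix (Fin.succ ∘ Fin.succ) (p.1.succAbove ∘ p.2.succAbove))| < m.factorial) →
      |per A| < perD m 2) := by
  have hsum : ∑ p : Fin (m + 2) × Fin (m + 1),
      (if (A 0 p.1 = A 1 p.1 ↔ A 0 (p.1.succAbove p.2) = A 1 (p.1.succAbove p.2)) then
        (m.factorial : ℚ) else 0) ≤ perD m 2 := by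
    have h := mul_le_mul_of_nonneg_right (sum_pairs_same_le _ heq hne)
      (Nat.cast_nonneg (α := ℚ) m.factorial)
    rw [Finset.sum_mul] at h
    simp only [ite_mul, one_mul, zero_mul] at h
    rw [perD_two]
    push_cast
    exact h
  have hle (p : Fin (m + 2) × Fin (m + 1)) :
      |per (A.submatrix (Fin.succ ∘ Fin.succ) (p.1.succAbove ∘ p.2.succAbove))| ≤ m.factorial :=
    abs_per_le_factorial _ fun i j => by
      rcases hA (Fin.succ (Fin.succ i)) ((p.1.succAbove ∘ p.2.succAbove) j) with h | h <;>
        simp only [submatrix_apply, Function.comp_apply] at h ⊢ <;> rw [h] <;> norm_num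
  refine ⟨(abs_per_le_two_rows A hA).trans ((Finset.sum_le_sum fun p _ => ?_).trans hsum), ?_⟩
  · split_ifs
    exacts [hle p, le_rfl]
  · rintro ⟨q, hq, hlt⟩
    refine lt_of_le_of_lt (abs_per_le_two_rows A hA) (lt_of_lt_of_le
      (Finset.sum_lt_sum (fun p _ => ?_) ⟨q, Finset.mem_univ q, ?_⟩) hsum)
    · split_ifs
      exacts [hle p, le_rfl]
    · rwa [if_pos hq, if_pos hq]

theorem far_bound {m l : ℕ} (hW : PerRankBound m)
    {A : Matrix (Fin (m + 2)) (Fin (m + 2)) ℚ} (hA : ∀ i j, A i j = 1 ∨ A i j = -1)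
    (heq : 2 ≤ (Finset.univ.filter fun j => A 0 j = A 1 j).card)
    (hne : 2 ≤ (Finset.univ.filter fun j => ¬ A 0 j = A 1 j).card)
    (hlm : l ≤ m) (hR : l ≤ (A.submatrix (Fin.succ ∘ Fin.succ) id).rank) :
    |per A| ≤ perD (m + 2 - l) l ∧ (A.rank = l + 1 → |per A| < perD (m + 2 - l) l) := by
  rcases Nat.lt_or_ge 2 l with hl | hl
  · have := abs_per_lt_of_far hW hA heq hne hl hlm hR
    exact ⟨this.le, fun _ => this⟩
  have hcard := Finset.card_filter_add_card_filter_not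
    (s := (Finset.univ : Finset (Fin (m + 2)))) fun j => A 0 j = A 1 j
  rw [Finset.card_univ, Fintype.card_fin] at hcard
  have hm : 2 ≤ m := by omega
  obtain ⟨hle, hlt⟩ := abs_per_le_of_far hA heq hne
  have h21 : perD m 2 < perD (m + 1) 1 := by
    have := perD_pos m 1 hm
    rw [perD_succ]
    linarith
  have h10 : perD (m + 1) 1 < perD (m + 2) 0 := by
    have := perD_pos (m + 1) 0 (by omega)
    rw [perD_succ]
    linarith
  interval_cases l
  · have : |per A| < perD (m + 2) 0 := hle.trans_lt (by exact_mod_cast h21.trans h10)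
    exact ⟨this.le, fun _ => this⟩
  · have : |per A| < perD (m + 1) 1 := hle.trans_lt (by exact_mod_cast h21)
    exact ⟨this.le, fun _ => this⟩
  refine ⟨hle, fun hrk => ?_⟩
  rcases hm.eq_or_lt with rfl | hm3
  · refine lt_of_le_of_ne hle fun h => ?_
    refine rank_ne_three_of_four hA ?_ ?_ ?_ hrk
    · have h1 : ∑ j, A 0 j * A 1 j = ∑ j, if A 0 j = A 1 j then 1 else -1 := by
        refine Finset.sum_congr rfl fun j _ => ?_
        rcases hA 0 j with h | h <;> rcases hA 1 j with h' | h' <;> rw [h, h'] <;> norm_num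
      rw [h1, Finset.sum_ite, Finset.sum_const, Finset.sum_const,
        show (Finset.univ.filter fun j => A 0 j = A 1 j).card = 2 by omega,
        show (Finset.univ.filter fun j => ¬ A 0 j = A 1 j).card = 2 by omega]
      norm_num
    · have : (![2, 3] : Fin 2 → Fin 4) = Fin.succ ∘ Fin.succ := by
        ext i
        fin_cases i <;> rfl
      rw [this]
      exact hR
    · rw [h, perD_two]
      norm_num [Nat.factorial]
  · apply hlt
    have hne0 (i j) : A i j ≠ 0 := by rcases hA i j with h | h <;> rw [h] <;> norm_num
    obtain ⟨i, i', j, j', hminor⟩ := exists_minor_ne_zero _ (fun i j => hne0 _ _) hR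
    obtain ⟨s, hs, t, ht, hst, hc⟩ := Finset.exists_ne_map_eq_of_card_lt_of_maps_to
      (s := (Finset.univ.erase j).erase j') (t := (Finset.univ : Finset Bool))
      (f := fun x => decide (A 0 x = A 1 x))
      (by
        have h1 := Finset.pred_card_le_card_erase (s := Finset.univ.erase j) (a := j')
        have h2 := Finset.card_erase_of_mem (Finset.mem_univ j)
        rw [Finset.card_univ, Fintype.card_fin] at h2
        rw [Finset.card_univ, Fintype.card_bool]
        omega)
      (fun _ _ => Finset.mem_univ _)
    simp only [Finset.mem_erase, Finset.mem_univ, and_true] at hs ht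
    obtain ⟨t, rfl⟩ := Fin.exists_succAbove_eq hst.symm
    refine ⟨(s, t), by simpa using hc, ?_⟩
    have hrange (x) (h1 : s ≠ x) (h2 : s.succAbove t ≠ x) :
        ∃ y, (s.succAbove ∘ t.succAbove) y = x := by
      obtain ⟨y, rfl⟩ := Fin.exists_succAbove_eq h1.symm
      obtain ⟨z, rfl⟩ := Fin.exists_succAbove_eq (fun h => h2 (congrArg s.succAbove h.symm) : y ≠ t)
      exact ⟨z, rfl⟩
    obtain ⟨x, hx⟩ := hrange j hs.2 ht.2
    obtain ⟨x', hx'⟩ := hrange j' hs.1 ht.1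
    have hrank := two_le_rank_of_minor
      (A.submatrix (Fin.succ ∘ Fin.succ) (s.succAbove ∘ t.succAbove)) (i := i) (i' := i')
      (j := x) (j' := x') (by simpa only [submatrix_apply, hx, hx', id] using hminor)
    refine (hW 1 _ (fun _ _ => hA _ _) (by omega) hrank).trans_lt ?_
    obtain ⟨m, rfl⟩ := Nat.exists_eq_add_of_le' (by omega : 1 ≤ m)
    have := perD_pos m 0 (by omega)
    rw [Nat.add_sub_cancel, ← Int.cast_natCast, ← perD_zero, perD_succ]
    exact_mod_cast (by linarith)

theorem far_bound_rows {m l : ℕ} (hW : PerRankBound m)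
    {A : Matrix (Fin (m + 2)) (Fin (m + 2)) ℚ} (hA : ∀ i j, A i j = 1 ∨ A i j = -1)
    {i i' : Fin (m + 2)} (hii : i ≠ i')
    (heq : 2 ≤ (Finset.univ.filter fun j => A i j = A i' j).card)
    (hne : 2 ≤ (Finset.univ.filter fun j => ¬ A i j = A i' j).card)
    (hlm : l ≤ m)
    (hR : ∀ κ : Fin m → Fin (m + 2), (∀ x, x ≠ i → x ≠ i' → x ∈ Set.range κ) →
      l ≤ (A.submatrix κ id).rank) :
    |per A| ≤ perD (m + 2 - l) l ∧ (A.rank = l + 1 → |per A| < perD (m + 2 - l) l) := by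
  obtain ⟨ρ, h0, h1⟩ : ∃ ρ : Equiv.Perm (Fin (m + 2)), ρ 0 = i ∧ ρ 1 = i' := by
    refine ⟨Equiv.swap 0 i * Equiv.swap 1 (Equiv.swap 0 i i'), ?_, by simp⟩
    have hk : 0 ≠ Equiv.swap 0 i i' := fun h =>
      hii ((Equiv.swap 0 i).injective ((Equiv.swap_apply_right 0 i).trans h))
    rw [Equiv.Perm.mul_apply, Equiv.swap_apply_of_ne_of_ne zero_ne_one hk, Equiv.swap_apply_left]
  have hper : per (A.submatrix ρ id) = per A := per_submatrix A ρ 1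
  have hrank : (A.submatrix ρ id).rank = A.rank := rank_submatrix A ρ (Equiv.refl _)
  rw [← hper, ← hrank]
  refine far_bound hW (fun _ _ => hA _ _) ?_ ?_ hlm ?_
  · simpa only [submatrix_apply, h0, h1, id] using heq
  · simpa only [submatrix_apply, h0, h1, id] using hne
  · refine hR (ρ ∘ Fin.succ ∘ Fin.succ) fun x hx hx' => ?_
    obtain ⟨y, rfl⟩ := ρ.surjective x
    obtain ⟨y, rfl⟩ := Fin.exists_succ_eq.2 (fun h => hx (by rw [h, h0]) : y ≠ 0)
    obtain ⟨y, rfl⟩ := Fin.exists_succ_eq.2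
      (fun h => hx' (by rw [h, Fin.succ_zero_eq_one, h1]) : y ≠ 0)
    exact ⟨y, rfl⟩

section RowRemoval

variable {m n : ℕ} (A : Matrix (Fin n) (Fin n) ℚ) (i i' : Fin n) (κ : Fin m → Fin n)

theorem finrank_sup_span_singleton_le {V : Type*} [AddCommGroup V] [Module ℚ V]
    [FiniteDimensional ℚ V] (S : Submodule ℚ V) (v : V) :
    Module.finrank ℚ ↥(S ⊔ Submodule.span ℚ {v}) ≤ Module.finrank ℚ S + 1 := by
  have h1 := Submodule.finrank_add_le_finrank_add_finrank S (Submodule.span ℚ {v})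
  have h2 := finrank_span_le_card (R := ℚ) ({v} : Set V)
  simp only [Set.toFinset_singleton, Finset.card_singleton] at h2
  omega

theorem rank_le_rank_remove_two (hκ : ∀ x, x ≠ i → x ≠ i' → x ∈ Set.range κ) :
    A.rank ≤ (A.submatrix κ id).rank + 2 := by
  rw [rank_eq_finrank_span_row, rank_eq_finrank_span_row]
  refine (Submodule.finrank_mono ?_).trans
    ((finrank_sup_span_singleton_le (Submodule.span ℚ (Set.range (A.submatrix κ id).row) ⊔
      Submodule.span ℚ {A.row i}) (A.row i')).trans
      (Nat.succ_le_succ (finrank_sup_span_singleton_le _ (A.row i))))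
  rw [Submodule.span_le]
  rintro _ ⟨x, rfl⟩
  by_cases hx' : x = i'
  · exact Submodule.mem_sup_right (hx' ▸ Submodule.mem_span_singleton_self _)
  refine Submodule.mem_sup_left ?_
  by_cases hx : x = i
  · exact Submodule.mem_sup_right (hx ▸ Submodule.mem_span_singleton_self _)
  obtain ⟨y, rfl⟩ := hκ x hx hx'
  exact Submodule.mem_sup_left (Submodule.subset_span ⟨y, rfl⟩)

theorem rank_le_rank_remove_two_of_mem_span
    (hi : A.row i ∈ Submodule.span ℚ (A.row '' (Set.univ \ {i})))
    (hκ : ∀ x, x ≠ i → x ≠ i' → x ∈ Set.range κ) :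
    A.rank ≤ (A.submatrix κ id).rank + 1 := by
  rw [rank_eq_finrank_span_row, rank_eq_finrank_span_row]
  refine (Submodule.finrank_mono ?_).trans (finrank_sup_span_singleton_le
    (Submodule.span ℚ (Set.range (A.submatrix κ id).row)) (A.row i'))
  have hother (x) (hx : x ≠ i) : A.row x ∈ Submodule.span ℚ (Set.range (A.submatrix κ id).row) ⊔
      Submodule.span ℚ {A.row i'} := by
    by_cases hx' : x = i'
    · exact Submodule.mem_sup_right (hx' ▸ Submodule.mem_span_singleton_self _)
    obtain ⟨y, rfl⟩ := hκ x hx hx'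
    exact Submodule.mem_sup_left (Submodule.subset_span ⟨y, rfl⟩)
  rw [Submodule.span_le]
  rintro _ ⟨x, rfl⟩
  by_cases hx : x = i
  · subst hx
    refine Submodule.span_le.2 ?_ hi
    rintro _ ⟨y, hy, rfl⟩
    exact hother y hy.2
  · exact hother x hx

end RowRemoval

theorem exists_row_rank_remove_two {m l : ℕ} (A : Matrix (Fin (m + 2)) (Fin (m + 2)) ℚ)
    (hlm : l ≤ m) (hrk : l + 1 ≤ A.rank) :
    ∃ i, ∀ i' (κ : Fin m → Fin (m + 2)), (∀ x, x ≠ i → x ≠ i' → x ∈ Set.range κ) →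
      l ≤ (A.submatrix κ id).rank := by
  by_cases hli : LinearIndependent ℚ A.row
  · refine ⟨0, fun i' κ hκ => ?_⟩
    have h1 := rank_le_rank_remove_two A 0 i' κ hκ
    have h2 := hli.rank_matrix
    rw [Fintype.card_fin] at h2
    omega
  · rw [linearIndependent_iff_notMem_span] at hli
    push Not at hli
    obtain ⟨i, hi⟩ := hli
    refine ⟨i, fun i' κ hκ => ?_⟩
    have := rank_le_rank_remove_two_of_mem_span A i i' κ hi hκ
    omega

theorem exists_stdEquiv_of_partial_perm {n : ℕ} {A C : Matrix (Fin n) (Fin n) ℚ} {ε δ : Fin n → ℚ}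
    (hε : ∀ i, ε i = 1 ∨ ε i = -1) (hδ : ∀ j, δ j = 1 ∨ δ j = -1)
    (hAC : ∀ i j, A i j = ε i * δ j * C i j) (hC : ∀ i j, C i j = 1 ∨ C i j = -1)
    (hrow : ∀ i j j', C i j = -1 → C i j' = -1 → j = j')
    (hcol : ∀ i i' j, C i j = -1 → C i' j = -1 → i = i') {i₀ : Fin n} (h₀ : ∀ j, C i₀ j = 1) :
    ∃ u, u + 1 ≤ n ∧ StdEquiv A (Dmat n u) := by
  classical
  let I : Finset (Fin n) := Finset.univ.filter fun i => ∃ j, C i j = -1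
  have hI (i) : i ∈ I ↔ ∃ j, C i j = -1 := by simp [I]
  let f (i : Fin n) : Fin n := if h : ∃ j, C i j = -1 then h.choose else i
  have hf {i : Fin n} (hi : i ∈ I) : C i (f i) = -1 := by
    have h := (hI i).1 hi
    simp only [f, dif_pos h]
    exact h.choose_spec
  obtain ⟨g, hg⟩ := Finset.exists_equiv_extend_of_card_eq (t := (Finset.univ : Finset (Fin n)))
    (s := I) (f := f) (by simp) (Finset.subset_univ _)
    (fun i hi i' hi' h => hcol i i' (f i) (hf hi) (h ▸ hf hi'))
  let τ : Equiv.Perm (Fin n) := g.trans (Equiv.subtypeUnivEquiv Finset.mem_univ)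
  have hτ (i) (hi : i ∈ I) : τ i = f i := hg i hi
  have hcard : Fintype.card {i // i ∈ I} = Fintype.card {k : Fin n // (k : ℕ) < I.card} := by
    rw [Fintype.card_coe, Fintype.card_subtype, Fin.card_filter_val_lt, min_eq_right]
    exact (Finset.card_le_univ I).trans_eq (Fintype.card_fin n)
  let e := Fintype.equivOfCardEq hcard
  let ρ := e.extendSubtype
  have hρ (i) : (ρ i : ℕ) < I.card ↔ i ∈ I := by
    by_cases hi : i ∈ I
    · exact ⟨fun _ => hi, fun _ => e.extendSubtype_mem i hi⟩
    · exact ⟨fun h => absurd h (e.extendSubtype_not_mem i hi), fun h => absurd h hi⟩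
  have hi₀ : i₀ ∉ I := by
    rw [hI]
    rintro ⟨j, hj⟩
    rw [h₀] at hj
    norm_num at hj
  refine ⟨I.card, ?_, ρ, τ.symm.trans ρ, ε, δ, hε, hδ, .inl fun i j => ?_⟩
  · have := Finset.card_lt_univ_of_notMem hi₀
    rwa [Fintype.card_fin] at this
  rw [hAC]
  congr 1
  simp only [Dmat, Equiv.trans_apply, hρ]
  obtain ⟨i', rfl⟩ := τ.surjective j
  rw [Equiv.symm_apply_apply]
  simp only [Fin.val_inj, ρ.injective.eq_iff]
  split_ifs with h
  · obtain ⟨rfl, h⟩ := h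
    rw [hτ i h, hf h]
  · refine (hC _ _).resolve_right fun h' => h ?_
    have hi : i ∈ I := (hI i).2 ⟨_, h'⟩
    have := hrow _ _ _ h' (hf hi)
    rw [← hτ i hi, τ.injective.eq_iff] at this
    exact ⟨this.symm, this ▸ hi⟩

/-- If two rows of a matrix with at most one `-1` in each row have their `-1` in the same column,
then two columns contain no `-1`. -/
theorem exists_two_free_columns {n : ℕ} {C : Matrix (Fin n) (Fin n) ℚ}
    (hrow : ∀ i j j', C i j = -1 → C i j' = -1 → j = j') {i₀ i₁ i₂ j : Fin n}
    (h₀ : ∀ k, C i₀ k ≠ -1) (h₁ : C i₁ j = -1) (h₂ : C i₂ j = -1) (h₁₂ : i₁ ≠ i₂) :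
    ∃ j₁ j₂, j₁ ≠ j₂ ∧ j₁ ≠ j ∧ (∀ i, C i j₁ ≠ -1) ∧ ∀ i, C i j₂ ≠ -1 := by
  classical
  let g (i : Fin n) : Fin n := if h : ∃ k, C i k = -1 then h.choose else j
  have hg (i k) (h : C i k = -1) : g i = k := by
    have hex : ∃ k, C i k = -1 := ⟨k, h⟩
    simp only [g, dif_pos hex]
    exact hrow i _ _ hex.choose_spec h
  let S : Finset (Fin n) := ((Finset.univ.erase i₀).erase i₁).erase i₂
  have h01 : i₁ ≠ i₀ := fun h => h₀ j (h ▸ h₁)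
  have h02 : i₂ ≠ i₀ := fun h => h₀ j (h ▸ h₂)
  have hS : S.card + 3 = n := by
    have a := Finset.card_erase_add_one (s := (Finset.univ.erase i₀).erase i₁) (a := i₂)
      (by simp [h02, h₁₂.symm])
    have b := Finset.card_erase_add_one (s := Finset.univ.erase i₀) (a := i₁) (by simp [h01])
    have c := Finset.card_erase_add_one (Finset.mem_univ i₀)
    rw [Finset.card_univ, Fintype.card_fin] at c
    change S.card + 1 = _ at a
    omega
  have hfree (k) (hk : k ∉ insert j (S.image g)) (i) : C i k ≠ -1 := by
    intro h
    refine hk (Finset.mem_insert.2 ?_)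
    by_cases hi₁ : i = i₁
    · exact .inl (hrow i₁ _ _ (hi₁ ▸ h) h₁)
    by_cases hi₂ : i = i₂
    · exact .inl (hrow i₂ _ _ (hi₂ ▸ h) h₂)
    refine .inr (Finset.mem_image.2 ⟨i, ?_, hg i k h⟩)
    simp only [S, Finset.mem_erase, Finset.mem_univ, and_true]
    exact ⟨hi₂, hi₁, fun h' => h₀ k (h' ▸ h)⟩
  have hcard : 1 < (insert j (S.image g))ᶜ.card := by
    rw [Finset.card_compl, Fintype.card_fin]
    have a := Finset.card_insert_le j (S.image g)
    have b := Finset.card_image_le (s := S) (f := g)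
    omega
  obtain ⟨j₁, hj₁, j₂, hj₂, hne⟩ := Finset.one_lt_card.1 hcard
  rw [Finset.mem_compl] at hj₁ hj₂
  exact ⟨j₁, j₂, hne, fun h => hj₁ (h ▸ Finset.mem_insert_self _ _), hfree _ hj₁, hfree _ hj₂⟩

theorem far_bound_or_stdEquiv {m l : ℕ} (hW : PerRankBound m)
    {A : Matrix (Fin (m + 2)) (Fin (m + 2)) ℚ} (hA : ∀ i j, A i j = 1 ∨ A i j = -1)
    (hlm : l ≤ m) (hrk : l + 1 ≤ A.rank) :
    (|per A| ≤ perD (m + 2 - l) l ∧ (A.rank = l + 1 → |per A| < perD (m + 2 - l) l)) ∨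
      ∃ u, u + 1 ≤ m + 2 ∧ StdEquiv A (Dmat (m + 2) u) := by
  obtain ⟨i₀, hi₀⟩ := exists_row_rank_remove_two A hlm hrk
  by_cases hfar : ∃ i, 2 ≤ (Finset.univ.filter fun j => A i₀ j = A i j).card ∧
      2 ≤ (Finset.univ.filter fun j => ¬ A i₀ j = A i j).card
  · obtain ⟨i, heq, hne⟩ := hfar
    have hii : i₀ ≠ i := by
      rintro rfl
      simp at hne
    exact .inl (far_bound_rows hW hA hii heq hne hlm (hi₀ i))
  let ε (i : Fin (m + 2)) : ℚ :=
    if (Finset.univ.filter fun j => ¬ A i₀ j = A i j).card ≤ 1 then 1 else -1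
  have hε (i) : ε i = 1 ∨ ε i = -1 := by
    simp only [ε]
    split_ifs <;> simp
  let C : Matrix (Fin (m + 2)) (Fin (m + 2)) ℚ := of fun i j => ε i * A i₀ j * A i j
  have hmul {x y : ℚ} (hx : x = 1 ∨ x = -1) (hy : y = 1 ∨ y = -1) : x * y = 1 ∨ x * y = -1 := by
    rcases hx with rfl | rfl <;> rcases hy with rfl | rfl <;> norm_num
  have hsq {x : ℚ} (hx : x = 1 ∨ x = -1) : x * x = 1 := by rcases hx with rfl | rfl <;> norm_num
  have hC (i j) : C i j = 1 ∨ C i j = -1 := hmul (hmul (hε i) (hA i₀ j)) (hA i j)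
  have hAC (i j) : A i j = ε i * A i₀ j * C i j := by
    change A i j = ε i * A i₀ j * (ε i * A i₀ j * A i j)
    rw [← mul_assoc, hsq (hmul (hε i) (hA i₀ j)), one_mul]
  have hstd : StdEquiv A C := ⟨1, 1, ε, A i₀, hε, hA i₀, .inl hAC⟩
  have hC₀ (j) : C i₀ j = 1 := by
    change ε i₀ * A i₀ j * A i₀ j = 1
    rw [mul_assoc, hsq (hA i₀ j), mul_one]
    simp [ε]
  have hrow (i j j') (h : C i j = -1) (h' : C i j' = -1) : j = j' := by
    by_cases hi : (Finset.univ.filter fun j => ¬ A i₀ j = A i j).card ≤ 1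
    · have hεi : ε i = 1 := if_pos hi
      have hmem (k) (hk : C i k = -1) : ¬ A i₀ k = A i k := by
        intro heq
        change ε i * A i₀ k * A i k = -1 at hk
        rw [hεi, one_mul, heq, hsq (hA i k)] at hk
        norm_num at hk
      exact Finset.card_le_one.1 hi j (by simpa using hmem j h) j' (by simpa using hmem j' h')
    · have hεi : ε i = -1 := if_neg hi
      have hi' : (Finset.univ.filter fun j => A i₀ j = A i j).card ≤ 1 := by
        by_contra hcon
        refine hi ?_
        by_contra h
        exact hfar ⟨i, by omega, by omega⟩
      have hmem (k) (hk : C i k = -1) : A i₀ k = A i k := by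
        change ε i * A i₀ k * A i k = -1 at hk
        rw [hεi] at hk
        rcases hA i₀ k with a | a <;> rcases hA i k with b | b <;> rw [a, b] at hk ⊢ <;>
          norm_num at hk
      exact Finset.card_le_one.1 hi' j (by simpa using hmem j h) j' (by simpa using hmem j' h')
  by_cases hcol : ∀ i i' j, C i j = -1 → C i' j = -1 → i = i'
  · exact .inr (exists_stdEquiv_of_partial_perm hε (hA i₀) hAC hC hrow hcol hC₀)
  push Not at hcol
  obtain ⟨i₁, i₂, j, h₁, h₂, h₁₂⟩ := hcol
  obtain ⟨j₁, j₂, hj₁₂, hj₁, hfree₁, hfree₂⟩ := exists_two_free_columns hrow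
    (fun k hk => by rw [hC₀] at hk; norm_num at hk) h₁ h₂ h₁₂
  have hone₁ (i) : C i j₁ = 1 := (hC i j₁).resolve_right (hfree₁ i)
  have hone₂ (i) : C i j₂ = 1 := (hC i j₂).resolve_right (hfree₂ i)
  by_cases hag : 2 ≤ (Finset.univ.filter fun i => C i j = 1).card
  · left
    rw [hstd.abs_per, hstd.rank_eq, ← per_transpose C, ← rank_transpose C]
    rw [hstd.rank_eq, ← rank_transpose C] at hrk
    refine far_bound_rows hW (fun i j => hC j i) hj₁ ?_ ?_ hlm fun κ hκ => ?_
    · simpa only [transpose_apply, hone₁, eq_comm] using hag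
    · refine Finset.one_lt_card.2 ⟨i₁, ?_, i₂, ?_, h₁₂⟩ <;>
        simp only [Finset.mem_filter, Finset.mem_univ, true_and, transpose_apply, hone₁, h₁, h₂] <;>
        norm_num
    · have hspan : Cᵀ.row j₁ ∈ Submodule.span ℚ (Cᵀ.row '' (Set.univ \ {j₁})) :=
        Submodule.subset_span ⟨j₂, ⟨trivial, hj₁₂.symm⟩, funext fun i =>
          (hone₂ i).trans (hone₁ i).symm⟩
      have := rank_le_rank_remove_two_of_mem_span Cᵀ j₁ j κ hspan hκ
      omega
  · right
    have honly (i) (hi : C i j = 1) : i = i₀ :=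
      Finset.card_le_one.1 (by omega : (Finset.univ.filter fun i => C i j = 1).card ≤ 1) i
        (by simpa using hi) i₀ (by simpa using hC₀ j)
    have hj (i) (hi : i ≠ i₀) : C i j = -1 := (hC i j).resolve_left fun h => hi (honly i h)
    have hk (i k) (hkj : k ≠ j) : C i k = 1 := by
      refine (hC i k).resolve_right fun h => ?_
      by_cases hi : i = i₀
      · rw [hi, hC₀] at h
        norm_num at h
      · exact hkj (hrow i _ _ h (hj i hi))
    let s (k : Fin (m + 2)) : ℚ := if k = j then -1 else 1
    have hs (k) : s k = 1 ∨ s k = -1 := by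
      simp only [s]
      split_ifs <;> simp
    let C' : Matrix (Fin (m + 2)) (Fin (m + 2)) ℚ := of fun i k => s k * C i k
    have hC' (i k) : C' i k = -1 ↔ i = i₀ ∧ k = j := by
      change s k * C i k = -1 ↔ _
      by_cases hkj : k = j
      · subst hkj
        by_cases hi : i = i₀
        · simp [hi, s, hC₀]
        · norm_num [hi, s, hj i hi]
      · norm_num [hkj, s, hk i k hkj]
    obtain ⟨i₃, hi₃⟩ := exists_ne i₀
    refine exists_stdEquiv_of_partial_perm (C := C') (δ := fun k => A i₀ k * s k) (i₀ := i₃) hε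
      (fun k => hmul (hA _ _) (hs k)) (fun i k => ?_) (fun i k => hmul (hs k) (hC i k))
      (fun i k k' h h' => ((hC' i k).1 h).2.trans ((hC' i k').1 h').2.symm)
      (fun i i' k h h' => ((hC' i k).1 h).1.trans ((hC' i' k).1 h').1.symm)
      (fun k => (hmul (hs k) (hC i₃ k)).resolve_right fun h => hi₃ ((hC' i₃ k).1 h).1)
    change A i k = ε i * (A i₀ k * s k) * (s k * C i k)
    rw [hAC i k]
    linear_combination (-ε i * A i₀ k * C i k) * hsq (hs k)

theorem abs_per_eq_of_stdEquiv {n u : ℕ} {A : Matrix (Fin n) (Fin n) ℚ} (hu : u + 1 ≤ n)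
    (h : StdEquiv A (Dmat n u)) : |per A| = perD (n - u) u := by
  rw [h.abs_per, per_Dmat n u (by omega), abs_of_nonneg]
  exact_mod_cast perD_nonneg (n - u) u (by omega)

theorem perRankBound (n : ℕ) : PerRankBound n := by
  induction n using Nat.strong_induction_on with
  | _ n ih =>
    intro l A hA hl hrk
    obtain ⟨m, rfl⟩ := Nat.exists_eq_add_of_le' (by omega : 2 ≤ n)
    rcases far_bound_or_stdEquiv (ih m (by omega)) hA (by omega) hrk with h | ⟨u, hu, h⟩
    · exact h.1
    · have hrank := h.rank_eq.trans (rank_Dmat _ u hu)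
      rw [abs_per_eq_of_stdEquiv hu h]
      exact_mod_cast perD_antitone (by omega : l ≤ u) hu

theorem krauter_singular (n k : ℕ) (hn : 2 ≤ n) (hk1 : 1 ≤ k) (hk : k ≤ n - 1)
    (A : Matrix (Fin n) (Fin n) ℚ) (hA : ∀ i j, A i j = 1 ∨ A i j = -1)
    (hrk : A.rank = k) :
    |per A| ≤ per (Dmat n (k - 1)) ∧
      (|per A| = per (Dmat n (k - 1)) → StdEquiv A (Dmat n (k - 1))) := by
  obtain ⟨l, rfl⟩ := Nat.exists_eq_add_of_le' hk1
  obtain ⟨m, rfl⟩ := Nat.exists_eq_add_of_le' hn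
  rw [Nat.add_sub_cancel, per_Dmat _ l (by omega)]
  rcases far_bound_or_stdEquiv (perRankBound m) hA (by omega : l ≤ m) hrk.ge with h | ⟨u, hu, h⟩
  · exact ⟨h.1, fun he => absurd he (h.2 hrk).ne⟩
  · have hrank := h.rank_eq.trans (rank_Dmat _ u hu)
    obtain rfl : u = l := by omega
    exact ⟨(abs_per_eq_of_stdEquiv hu h).le, fun _ => h⟩
end

section
/- For all integers n, k with 1 ≤ k ≤ n, the identity per D_{(n,k−1)} = per D_{(n,k)} + 2·per D_{(n−1,k−1)} holds. -/
open Matrix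

/-- The permutations of `Fin (m + 1)`, parametrized as in `Equiv.Perm.decomposeOption` with the
point `p` in the role of `none`. -/
def permDecomposeAt {m : ℕ} (p : Fin (m + 1)) :
    Option (Fin m) × Equiv.Perm (Fin m) ≃ Equiv.Perm (Fin (m + 1)) :=
  Equiv.Perm.decomposeOption.symm.trans (Equiv.permCongr (finSuccEquiv' p).symm)

theorem permDecomposeAt_self {m : ℕ} (p : Fin (m + 1)) (o : Option (Fin m))
    (σ : Equiv.Perm (Fin m)) : permDecomposeAt p (o, σ) p = (finSuccEquiv' p).symm o := by
  simp [permDecomposeAt]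

theorem permDecomposeAt_none_succAbove {m : ℕ} (p : Fin (m + 1)) (σ : Equiv.Perm (Fin m))
    (i : Fin m) : permDecomposeAt p (none, σ) (p.succAbove i) = p.succAbove (σ i) := by
  simp [permDecomposeAt]

/-- Changing the diagonal entry at `p` changes the permanent by the change of the entry times the
complementary principal subpermanent. -/
theorem per_eq_add_of_eq_off_diag {m : ℕ} {A B : Matrix (Fin (m + 1)) (Fin (m + 1)) ℚ}
    (p : Fin (m + 1)) (h : ∀ i j, (i = p → j ≠ p) → A i j = B i j) :
    per A = per B + (A p p - B p p) * per (A.submatrix p.succAbove p.succAbove) := by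
  have key : ∀ M : Matrix (Fin (m + 1)) (Fin (m + 1)) ℚ,
      per M = M p p * per (M.submatrix p.succAbove p.succAbove) +
        ∑ o : Fin m, ∑ σ : Equiv.Perm (Fin m), ∏ i, M i (permDecomposeAt p (some o, σ) i) := by
    intro M
    simp only [per]
    rw [← (permDecomposeAt p).sum_comp, Fintype.sum_prod_type, Fintype.sum_option]
    simp [Fin.prod_univ_succAbove _ p, permDecomposeAt_self, permDecomposeAt_none_succAbove,
      Finset.mul_sum]
  have hsub : A.submatrix p.succAbove p.succAbove = B.submatrix p.succAbove p.succAbove := by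
    ext i j
    exact h _ _ fun hi => absurd hi (Fin.succAbove_ne p i)
  have hsome : ∀ (o : Fin m) (σ : Equiv.Perm (Fin m)),
      ∏ i, A i (permDecomposeAt p (some o, σ) i) = ∏ i, B i (permDecomposeAt p (some o, σ) i) := by
    refine fun o σ => Finset.prod_congr rfl fun i _ => h _ _ ?_
    rintro rfl
    simp [permDecomposeAt_self]
  rw [key A, key B, hsub]
  simp only [hsome]
  ring

theorem Dmat_submatrix_succAbove {m : ℕ} (p : Fin (m + 1)) :
    (Dmat (m + 1) p).submatrix p.succAbove p.succAbove = Dmat m p := by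
  ext i j
  simp only [Dmat, Matrix.submatrix_apply, Fin.val_inj, Fin.succAbove_right_inj]
  congr 2
  simp only [Fin.succAbove, Fin.lt_def, Fin.val_castSucc]
  split_ifs <;> grind

theorem per_D_recurrence (n k : ℕ) (hk1 : 1 ≤ k) (hkn : k ≤ n) :
    per (Dmat n (k - 1)) = per (Dmat n k) + 2 * per (Dmat (n - 1) (k - 1)) := by
  obtain ⟨l, rfl⟩ := Nat.exists_eq_add_of_le' hk1
  obtain ⟨m, rfl⟩ := Nat.exists_eq_add_of_le' (hk1.trans hkn)
  change per (Dmat (m + 1) l) = per (Dmat (m + 1) (l + 1)) + 2 * per (Dmat m l)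
  let p : Fin (m + 1) := ⟨l, by omega⟩
  have h := per_eq_add_of_eq_off_diag (A := Dmat (m + 1) l) (B := Dmat (m + 1) (l + 1)) p ?_
  · rw [h, Dmat_submatrix_succAbove p]
    norm_num [Dmat, p]
  · intro i j hij
    simp only [Dmat]
    congr 1
    simp only [Fin.ext_iff, p, ne_eq] at hij
    simp only [eq_iff_iff]
    omega
end

section
/- Let A be a nonsingular 6×6 (−1,1)-matrix. Then |per A| ≤ per D_{(6,5)} (= 128), and equality holds if and only if A can be obtained from D_{(6,5)} by standard transformations. -/
open Matrix

/-- The sum of `∏ i, a i (f i)` over the injective `f` that avoid the columns in `used`,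
computed row by row. -/
def injSum {m : ℕ} : {k : ℕ} → (Fin k → Fin m → ℤ) → List (Fin m) → ℤ
  | 0, _, _ => 1
  | _ + 1, a, used =>
      ∑ c, if c ∈ used then 0 else a 0 c * injSum (fun i => a i.succ) (c :: used)

theorem injSum_eq {m : ℕ} : ∀ {k : ℕ} (a : Fin k → Fin m → ℤ) (used : List (Fin m)),
    injSum a used = ∑ f : Fin k → Fin m,
      if Function.Injective f ∧ ∀ i, f i ∉ used then ∏ i, a i (f i) else 0
  | 0, a, used => by simp [injSum, Function.injective_of_subsingleton]
  | k + 1, a, used => by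
    rw [injSum, ← (Fin.consEquiv fun _ : Fin (k + 1) => Fin m).sum_comp, Fintype.sum_prod_type]
    refine Finset.sum_congr rfl fun c _ => ?_
    by_cases hc : c ∈ used
    · simp [hc, Fin.forall_fin_succ, Fin.consEquiv]
    · rw [if_neg hc, injSum_eq, Finset.mul_sum]
      refine Finset.sum_congr rfl fun f _ => ?_
      have hinj : Function.Injective ((Fin.consEquiv fun _ : Fin (k + 1) => Fin m) (c, f)) ↔
          (∀ i, f i ≠ c) ∧ Function.Injective f := by
        change Function.Injective (Fin.cons c f : Fin (k + 1) → Fin m) ↔ _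
        simp [Fin.cons_injective_iff]
      simp only [Fin.consEquiv_apply, Fin.forall_fin_succ, Fin.cons_zero, Fin.cons_succ,
        Fin.prod_univ_succ, List.mem_cons, not_or, mul_ite, mul_zero, hc, not_false_eq_true,
        true_and, forall_and]
      refine if_congr ?_ rfl rfl
      rw [hinj]
      tauto

theorem sum_perm_eq_injSum {n : ℕ} (a : Fin n → Fin n → ℤ) :
    ∑ σ : Equiv.Perm (Fin n), ∏ i, a i (σ i) = injSum a [] := by
  rw [injSum_eq]
  simp only [List.not_mem_nil, not_false_eq_true, implies_true, and_true, ← Finset.sum_filter]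
  symm
  refine Finset.sum_bij
    (fun f h => Equiv.ofBijective f (Finite.injective_iff_bijective.mp (Finset.mem_filter.mp h).2))
    (fun _ _ => Finset.mem_univ _) (fun f _ g _ h => ?_) (fun σ _ => ?_) (fun _ _ => rfl)
  · exact congrArg (fun σ : Equiv.Perm (Fin n) => (σ : Fin n → Fin n)) h
  · exact ⟨σ, by simp [σ.injective], by ext; rfl⟩

/-- The `j`-th sign of the row whose negative entries are the binary digits `1` of `m`. -/
def sgn (m j : ℕ) : ℤˣ := if m.testBit j then -1 else 1

/-- The sum of the entries of a list, with the signs given by `m`. -/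
def signedSum : ℕ → List ℤ → ℤ
  | _, [] => 0
  | m, w :: ws => (if m.testBit 0 then -w else w) + signedSum (m / 2) ws

theorem signedSum_ofFn : ∀ {k : ℕ} (m : ℕ) (f : Fin k → ℤ),
    signedSum m (List.ofFn f) = ∑ j : Fin k, (sgn m j : ℤ) * f j
  | 0, m, f => by simp [signedSum]
  | k + 1, m, f => by
    rw [List.ofFn_succ, signedSum, signedSum_ofFn, Fin.sum_univ_succ]
    congr 1
    · by_cases h : m.testBit 0 = true <;> simp only [sgn, Fin.val_zero, h] <;> simp
    · simp [sgn, Nat.testBit_succ]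

/-- The coefficients of the permanent as a trilinear form in the first three rows, when the
other three rows are given by the masks `0`, `3`, `s`. -/
def baseTensor (s : ℕ) : List (List (List ℤ)) :=
  List.ofFn fun i : Fin 6 => List.ofFn fun j : Fin 6 => List.ofFn fun k : Fin 6 =>
    if j ∈ [i] ∨ k ∈ [j, i] then 0
    else injSum (fun (t : Fin 3) (j : Fin 6) => (sgn (![0, 3, s] t) j : ℤ)) [k, j, i]

/-- The integer permanent of a sign matrix. -/
def perZ (a : Fin 6 → Fin 6 → ℤˣ) : ℤ := ∑ σ : Equiv.Perm (Fin 6), ∏ i, (a i (σ i) : ℤ)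

/-- The sign matrix whose rows are given by the masks `x`, `y`, `z`, `0`, `3`, `s`. -/
def maskMatrix (x y z s : ℕ) (i j : Fin 6) : ℤˣ := sgn (![x, y, z, 0, 3, s] i) j

theorem perZ_maskMatrix (x y z s : ℕ) : perZ (maskMatrix x y z s) =
    signedSum x (((baseTensor s).map (·.map (signedSum z))).map (signedSum y)) := by
  rw [perZ, sum_perm_eq_injSum (fun i j => (maskMatrix x y z s i j : ℤ))]
  simp only [baseTensor, List.map_ofFn, Function.comp_def, signedSum_ofFn, injSum]
  refine Finset.sum_congr rfl fun i _ => ?_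
  simp only [List.not_mem_nil, if_false]
  refine congrArg _ (Finset.sum_congr rfl fun j _ => ?_)
  by_cases hj : j ∈ [i]
  · simp [hj]
  · simp only [hj, if_false, false_or]
    refine congrArg _ (Finset.sum_congr rfl fun k _ => ?_)
    split
    · simp
    · congr 1

/-- Up to sign, every row differs from one central row in a single column. -/
def IsStar (a : Fin 6 → Fin 6 → ℤˣ) : Prop :=
  ∃ r, ∀ i, i ≠ r → ∃ (c : Fin 6) (s : ℤˣ), ∀ j, a i j = s * (if j = c then -1 else 1) * a r j

instance (a : Fin 6 → Fin 6 → ℤˣ) : Decidable (IsStar a) := by unfold IsStar; infer_instance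

/-- Boolean test that every `maskMatrix x y z s` with distinct masks below `32` has permanent
less than `128` in absolute value or is a star. For most `y`, `z` the bound holds for all `x`
because the coefficients of the permanent as a linear form in the first row are small. -/
def smallOrStar (s : ℕ) : Bool :=
  (List.range 32).all fun z => z ∈ [0, 3, s] ||
    let V := (baseTensor s).map (·.map (signedSum z))
    (List.range 32).all fun y => y ∈ [z, 0, 3, s] ||
      let w := V.map (signedSum y)
      decide ((w.map Int.natAbs).sum < 128) ||
        (List.range 32).all fun x => x ∈ [y, z, 0, 3, s] ||
          decide ((signedSum x w).natAbs < 128) || decide (IsStar (maskMatrix x y z s))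

theorem smallOrStar_five : smallOrStar 5 = true := by decide +kernel

theorem smallOrStar_twelve : smallOrStar 12 = true := by decide +kernel

theorem natAbs_signedSum_le : ∀ (m : ℕ) (w : List ℤ),
    (signedSum m w).natAbs ≤ (w.map Int.natAbs).sum
  | _, [] => by simp [signedSum]
  | m, a :: w => by
    have := natAbs_signedSum_le (m / 2) w
    simp only [signedSum, List.map_cons, List.sum_cons]
    split <;> omega

theorem abs_perZ_lt_or_isStar_maskMatrix {x y z s : ℕ} (hs : s = 5 ∨ s = 12) (hx : x < 32)
    (hy : y < 32) (hz : z < 32) (h : [x, y, z, 0, 3, s].Nodup) :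
    |perZ (maskMatrix x y z s)| < 128 ∨ IsStar (maskMatrix x y z s) := by
  have hcheck : smallOrStar s = true := by
    rcases hs with rfl | rfl
    exacts [smallOrStar_five, smallOrStar_twelve]
  simp only [List.nodup_cons] at h
  obtain ⟨hxn, hyn, hzn, -⟩ := h
  rw [perZ_maskMatrix, Int.abs_eq_natAbs]
  simp only [smallOrStar, List.all_eq_true, List.mem_range, Bool.or_eq_true, decide_eq_true_eq]
    at hcheck
  rcases (hcheck z hz).resolve_left hzn y hy with h | h | h
  · exact absurd h hyn
  · exact .inl (by exact_mod_cast (natAbs_signedSum_le _ _).trans_lt h)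
  · rcases h x hx with (h | h) | h
    · exact absurd h hxn
    · exact .inl (by exact_mod_cast h)
    · exact .inr h

/-- No two rows agree up to sign. -/
def RowIndep (a : Fin 6 → Fin 6 → ℤˣ) : Prop :=
  ∀ i k (s : ℤˣ), (∀ j, a i j = s * a k j) → i = k

/-- Permute the rows and columns of a sign matrix and change their signs. -/
def transform (ε δ : Fin 6 → ℤˣ) (ρ σ : Equiv.Perm (Fin 6)) (a : Fin 6 → Fin 6 → ℤˣ)
    (i j : Fin 6) : ℤˣ :=
  ε i * δ j * a (ρ i) (σ j)

section Transform

variable {ε δ : Fin 6 → ℤˣ} {ρ σ : Equiv.Perm (Fin 6)} {a : Fin 6 → Fin 6 → ℤˣ}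

theorem RowIndep.transform (h : RowIndep a) : RowIndep (transform ε δ ρ σ a) := by
  refine fun i k s hik => ρ.injective (h _ _ (ε i * s * ε k) fun j => ?_)
  have := congrArg (ε i * δ (σ.symm j) * ·) (hik (σ.symm j))
  simp only [_root_.transform, Equiv.apply_symm_apply] at this
  rw [← one_mul (a (ρ i) j), ← Int.units_mul_self (ε i * δ (σ.symm j)), mul_assoc _ _ (a _ _), this]
  rw [← one_mul (ε i * s * ε k * _), ← Int.units_mul_self (δ (σ.symm j))]
  ac_rfl

theorem IsStar.of_transform (h : IsStar (transform ε δ ρ σ a)) : IsStar a := by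
  obtain ⟨r, h⟩ := h
  refine ⟨ρ r, fun i hi => ?_⟩
  obtain ⟨c, s, h⟩ := h (ρ.symm i) (by rwa [Ne, Equiv.symm_apply_eq])
  refine ⟨σ c, ε (ρ.symm i) * s * ε r, fun j => ?_⟩
  have := congrArg (ε (ρ.symm i) * δ (σ.symm j) * ·) (h (σ.symm j))
  simp only [transform, Equiv.apply_symm_apply, Equiv.symm_apply_eq] at this
  generalize (if j = σ c then (-1 : ℤˣ) else 1) = t at this ⊢
  rw [← one_mul (a i j), ← Int.units_mul_self (ε (ρ.symm i) * δ (σ.symm j)), mul_assoc _ _ (a _ _),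
    this]
  rw [← one_mul (ε (ρ.symm i) * s * ε r * t * _), ← Int.units_mul_self (δ (σ.symm j))]
  ac_rfl

theorem abs_perZ_transform : |perZ (transform ε δ ρ σ a)| = |perZ a| := by
  have h : perZ (transform ε δ ρ σ a) =
      ((∏ i, ε i : ℤˣ) : ℤ) * ((∏ j, δ j : ℤˣ) : ℤ) * perZ a := by
    rw [perZ, perZ, Finset.mul_sum]
    refine Fintype.sum_equiv ((Equiv.mulRight ρ⁻¹).trans (Equiv.mulLeft σ)) _ _ fun τ => ?_
    simp only [transform, Units.val_mul, Finset.prod_mul_distrib, Units.coe_prod]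
    congr 1
    · congr 1
      exact Equiv.prod_comp τ fun j => (δ j : ℤ)
    · rw [← Equiv.prod_comp ρ fun i => (a i _ : ℤ)]
      simp
  rw [h, abs_mul, abs_mul, Int.isUnit_iff_abs_eq.mp (Units.isUnit _),
    Int.isUnit_iff_abs_eq.mp (Units.isUnit _), one_mul, one_mul]

end Transform

theorem exists_perm_extend (f : Fin 6 → Fin 6) (s : Set (Fin 6)) (hf : Set.InjOn f s) :
    ∃ σ : Equiv.Perm (Fin 6), ∀ i ∈ s, σ i = f i := by
  obtain ⟨g, hg⟩ := Set.MapsTo.exists_equiv_extend_of_card_eq (t := Finset.univ) (by simp)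
    (fun i _ => Finset.mem_coe.mpr (Finset.mem_univ (f i))) hf
  exact ⟨g.trans (Equiv.subtypeUnivEquiv Finset.mem_univ), hg⟩

/-- The sign vector that is negative at `a` and `b`. -/
def pairSign (a b j : Fin 6) : ℤˣ := if j = a ∨ j = b then -1 else 1

theorem pairSign_comm (a b : Fin 6) : pairSign a b = pairSign b a := by
  ext j; simp [pairSign, or_comm]

theorem exists_pairSign (v : Fin 6 → ℤˣ) (hv : ∏ j, v j = 1) :
    (∃ s, ∀ j, v j = s) ∨ ∃ s a b, a ≠ b ∧ ∀ j, v j = s * pairSign a b j := by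
  revert v
  decide +kernel

theorem pairSign_apply_perm (σ : Equiv.Perm (Fin 6)) (i k j : Fin 6) :
    pairSign (σ i) (σ k) (σ j) = pairSign i k j := by
  simp [pairSign]

theorem pairSign_zero_one (j : Fin 6) : pairSign 0 1 j = sgn 3 j := by revert j; decide
theorem pairSign_zero_two (j : Fin 6) : pairSign 0 2 j = sgn 5 j := by revert j; decide
theorem pairSign_two_three (j : Fin 6) : pairSign 2 3 j = sgn 12 j := by revert j; decide

theorem exists_perm_pairSign_overlap {a b d : Fin 6} (hab : a ≠ b) (had : a ≠ d) (hbd : b ≠ d) :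
    ∃ (σ : Equiv.Perm (Fin 6)) (s : ℕ), (s = 5 ∨ s = 12) ∧
      (∀ j, pairSign a b (σ j) = sgn 3 j) ∧ ∀ j, pairSign a d (σ j) = sgn s j := by
  obtain ⟨σ, hσ⟩ := exists_perm_extend ![a, b, d, 0, 0, 0] {i | i < 3} (by
    intro i hi k hk h
    fin_cases i <;> fin_cases k <;> simp_all [Fin.lt_def])
  have h0 : σ 0 = a := hσ 0 (by decide)
  have h1 : σ 1 = b := hσ 1 (by decide)
  have h2 : σ 2 = d := hσ 2 (by decide)
  refine ⟨σ, 5, .inl rfl, fun j => ?_, fun j => ?_⟩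
  · rw [← h0, ← h1, pairSign_apply_perm, pairSign_zero_one]
  · rw [← h0, ← h2, pairSign_apply_perm, pairSign_zero_two]

theorem exists_perm_pairSign {a b c d : Fin 6} (hab : a ≠ b) (hcd : c ≠ d)
    (hne : pairSign a b ≠ pairSign c d) :
    ∃ (σ : Equiv.Perm (Fin 6)) (s : ℕ), (s = 5 ∨ s = 12) ∧
      (∀ j, pairSign a b (σ j) = sgn 3 j) ∧ ∀ j, pairSign c d (σ j) = sgn s j := by
  by_cases hac : a = c
  · subst hac
    exact exists_perm_pairSign_overlap hab hcd fun h => hne (by rw [h])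
  by_cases had : a = d
  · subst had
    rw [pairSign_comm c] at hne ⊢
    exact exists_perm_pairSign_overlap hab hcd.symm fun h => hne (by rw [h])
  by_cases hbc : b = c
  · subst hbc
    rw [pairSign_comm a] at hne ⊢
    exact exists_perm_pairSign_overlap hab.symm hcd fun h => hne (by rw [h])
  by_cases hbd : b = d
  · subst hbd
    rw [pairSign_comm a, pairSign_comm c] at hne ⊢
    exact exists_perm_pairSign_overlap hab.symm hcd.symm fun h => hne (by rw [h])
  obtain ⟨σ, hσ⟩ := exists_perm_extend ![a, b, c, d, 0, 0] {i | i < 4} (by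
    intro i hi k hk h
    fin_cases i <;> fin_cases k <;> simp_all [Fin.lt_def, eq_comm])
  have h0 : σ 0 = a := hσ 0 (by decide)
  have h1 : σ 1 = b := hσ 1 (by decide)
  have h2 : σ 2 = c := hσ 2 (by decide)
  have h3 : σ 3 = d := hσ 3 (by decide)
  refine ⟨σ, 12, .inr rfl, fun j => ?_, fun j => ?_⟩
  · rw [← h0, ← h1, pairSign_apply_perm, pairSign_zero_one]
  · rw [← h2, ← h3, pairSign_apply_perm, pairSign_two_three]

theorem exists_mask (v : Fin 6 → ℤˣ) (hv : v 5 = 1) : ∃ m < 32, ∀ j : Fin 6, v j = sgn m j := by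
  refine ⟨Nat.ofBits fun j : Fin 5 => decide (v j.castSucc = -1), Nat.ofBits_lt_two_pow _,
    fun j => ?_⟩
  refine Fin.lastCases ?_ (fun j => ?_) j
  · simpa [sgn] using hv
  · rcases Int.units_eq_one_or (v j.castSucc) with h | h <;> simp [sgn, h]

theorem exists_three_rows_prod_eq (a : Fin 6 → Fin 6 → ℤˣ) :
    ∃ i₀ i₁ i₂, i₀ ≠ i₁ ∧ i₀ ≠ i₂ ∧ i₁ ≠ i₂ ∧
      ∏ j, a i₁ j = ∏ j, a i₀ j ∧ ∏ j, a i₂ j = ∏ j, a i₀ j := by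
  obtain ⟨p, hp⟩ := Fintype.exists_lt_card_fiber_of_mul_lt_card (n := 2)
    (fun i => ∏ j, a i j) (by decide)
  obtain ⟨i₀, i₁, i₂, h₀, h₁, h₂, h⟩ := Finset.two_lt_card_iff.mp hp
  simp only [Finset.mem_filter, Finset.mem_univ, true_and] at h₀ h₁ h₂
  exact ⟨i₀, i₁, i₂, h.1, h.2.1, h.2.2, h₁.trans h₀.symm, h₂.trans h₀.symm⟩

theorem exists_transform_eq_maskMatrix {a : Fin 6 → Fin 6 → ℤˣ} (ha : RowIndep a) :
    ∃ ε δ ρ σ, ∃ x < 32, ∃ y < 32, ∃ z < 32, ∃ s, (s = 5 ∨ s = 12) ∧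
      transform ε δ ρ σ a = maskMatrix x y z s := by
  obtain ⟨i₀, i₁, i₂, h01, h02, h12, hp1, hp2⟩ := exists_three_rows_prod_eq a
  have hpair : ∀ i, i ≠ i₀ → ∏ j, a i j = ∏ j, a i₀ j →
      ∃ s p q, p ≠ q ∧ ∀ j, a i j * a i₀ j = s * pairSign p q j := by
    intro i hi hprod
    refine (exists_pairSign (fun j => a i j * a i₀ j) ?_).resolve_left ?_
    · rw [Finset.prod_mul_distrib, hprod, Int.units_mul_self]
    · rintro ⟨s, hs⟩
      exact hi (ha i i₀ s fun j => by rw [← hs j, mul_assoc, Int.units_mul_self, mul_one])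
  obtain ⟨s₁, p, q, hpq, h₁⟩ := hpair i₁ h01.symm hp1
  obtain ⟨s₂, p', q', hpq', h₂⟩ := hpair i₂ h02.symm hp2
  obtain ⟨σ, s, hs, hσ₁, hσ₂⟩ := exists_perm_pairSign hpq hpq' (fun h => h12 (ha i₁ i₂ (s₁ * s₂)
    fun j => by
      have e₁ := congrArg (· * a i₀ j) (h₁ j)
      have e₂ := congrArg (· * a i₀ j) (h₂ j)
      simp only [mul_assoc, Int.units_mul_self, mul_one] at e₁ e₂
      rw [e₁, e₂, h, mul_assoc, ← mul_assoc s₂ s₂, Int.units_mul_self, one_mul]))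
  obtain ⟨ρ, hρ⟩ := exists_perm_extend ![0, 0, 0, i₀, i₁, i₂] {i | 3 ≤ i} (by
    intro i hi k hk h
    fin_cases i <;> fin_cases k <;> simp_all [Fin.le_def, eq_comm])
  have hρ3 : ρ 3 = i₀ := hρ 3 (by decide)
  have hρ4 : ρ 4 = i₁ := hρ 4 (by decide)
  have hρ5 : ρ 5 = i₂ := hρ 5 (by decide)
  have hmask (i : Fin 6) := exists_mask
    (fun j => a (ρ i) (σ 5) * a i₀ (σ 5) * a i₀ (σ j) * a (ρ i) (σ j))
    (by rw [mul_assoc, mul_comm (a i₀ (σ 5)) (a (ρ i) (σ 5)), Int.units_mul_self])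
  choose m hm hmj using hmask
  refine ⟨![a (ρ 0) (σ 5) * a i₀ (σ 5), a (ρ 1) (σ 5) * a i₀ (σ 5), a (ρ 2) (σ 5) * a i₀ (σ 5),
    1, s₁, s₂], fun j => a i₀ (σ j), ρ, σ, m 0, hm 0, m 1, hm 1, m 2, hm 2, s, hs, ?_⟩
  have hrow : ∀ {i t p q}, (∀ j, a i j * a i₀ j = t * pairSign p q j) → ∀ j,
      t * a i₀ j * a i j = pairSign p q j := fun h j => by
    rw [mul_assoc, mul_comm (a i₀ j), h, ← mul_assoc, Int.units_mul_self, one_mul]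
  ext i j : 2
  fin_cases i
  · exact hmj 0 j
  · exact hmj 1 j
  · exact hmj 2 j
  · change 1 * a i₀ (σ j) * a (ρ 3) (σ j) = sgn 0 j
    rw [hρ3, one_mul, Int.units_mul_self]
    simp [sgn]
  · change s₁ * a i₀ (σ j) * a (ρ 4) (σ j) = sgn 3 j
    rw [hρ4, hrow h₁, hσ₁]
  · change s₂ * a i₀ (σ j) * a (ρ 5) (σ j) = sgn s j
    rw [hρ5, hrow h₂, hσ₂]

theorem abs_perZ_lt_or_isStar {a : Fin 6 → Fin 6 → ℤˣ} (ha : RowIndep a) :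
    |perZ a| < 128 ∨ IsStar a := by
  obtain ⟨ε, δ, ρ, σ, x, hx, y, hy, z, hz, s, hs, h⟩ := exists_transform_eq_maskMatrix ha
  have hind : RowIndep (maskMatrix x y z s) := h ▸ ha.transform
  have hnodup : [x, y, z, 0, 3, s].Nodup := by
    change (List.ofFn ![x, y, z, 0, 3, s]).Nodup
    refine List.nodup_ofFn.mpr fun i k hik => hind i k 1 fun j => ?_
    rw [maskMatrix, hik, one_mul, maskMatrix]
  rw [← abs_perZ_transform (ε := ε) (δ := δ) (ρ := ρ) (σ := σ), h]
  exact (abs_perZ_lt_or_isStar_maskMatrix hs hx hy hz hnodup).imp_right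
    fun hstar => IsStar.of_transform (h ▸ hstar)

/-- The matrix `D_{(6,5)}` with entries in `ℤˣ`. -/
def unitsDmat (i j : Fin 6) : ℤˣ := if (i : ℕ) = (j : ℕ) ∧ (j : ℕ) < 5 then -1 else 1

/-- A star is `D_{(6,5)}` up to row and column permutations and sign changes. -/
theorem IsStar.exists_transform {a : Fin 6 → Fin 6 → ℤˣ} (h : IsStar a) (ha : RowIndep a) :
    ∃ ε δ ρ σ, a = transform ε δ ρ σ unitsDmat := by
  obtain ⟨r, h⟩ := h
  have h' : ∀ i, ∃ (c : Fin 6) (s : ℤˣ), i ≠ r →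
      ∀ j, a i j = s * (if j = c then -1 else 1) * a r j := fun i => by
    by_cases hi : i = r
    · exact ⟨0, 1, fun h => absurd hi h⟩
    · obtain ⟨c, s, hcs⟩ := h i hi
      exact ⟨c, s, fun _ => hcs⟩
  choose c s hcs using h'
  obtain ⟨τ, hτ⟩ := exists_perm_extend c {i | i ≠ r} (fun i hi k hk hik =>
    ha i k (s i * s k) fun j => by
      rw [hcs i hi, hcs k hk, hik]
      rw [← one_mul (s i * _ * _), ← Int.units_mul_self (s k)]
      ac_rfl)
  refine ⟨fun i => if i = r then 1 else s i, fun j => a r j, Equiv.swap r 5,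
    τ.symm.trans (Equiv.swap r 5), ?_⟩
  ext i j : 2
  have hlt : ∀ k : Fin 6, (k : ℕ) < 5 ↔ k ≠ 5 := by decide
  simp only [transform, unitsDmat, Equiv.trans_apply, Fin.val_inj, hlt, EmbeddingLike.apply_eq_iff_eq,
    Equiv.eq_symm_apply]
  by_cases hi : i = r
  · subst hi
    have hne : ¬(τ i = j ∧ Equiv.swap i 5 (τ.symm j) ≠ 5) := by
      rintro ⟨rfl, h⟩
      exact h (by rw [Equiv.symm_apply_apply, Equiv.swap_apply_left])
    rw [if_pos rfl, if_neg hne, one_mul, mul_one]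
  · rw [if_neg hi, hcs i hi j, mul_right_comm]
    congr 1
    refine if_congr ?_ rfl rfl
    rw [hτ i hi]
    constructor
    · rintro rfl
      refine ⟨rfl, ?_⟩
      rw [← hτ i hi, Equiv.symm_apply_apply]
      exact fun h5 => hi ((Equiv.swap r 5).injective (h5.trans (Equiv.swap_apply_left r 5).symm))
    · exact fun h => h.1.symm

theorem per_intCast (a : Fin 6 → Fin 6 → ℤˣ) : per (fun i j => ((a i j : ℤ) : ℚ)) = perZ a := by
  simp [per, perZ]

theorem Dmat_six_five : Dmat 6 5 = fun i j => ((unitsDmat i j : ℤ) : ℚ) := by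
  ext i j
  simp only [Dmat, unitsDmat]
  split <;> simp

theorem perZ_unitsDmat : perZ unitsDmat = 128 := by
  rw [perZ, sum_perm_eq_injSum fun i j => (unitsDmat i j : ℤ)]
  decide +kernel

theorem per_Dmat_six_five : per (Dmat 6 5) = 128 := by
  rw [Dmat_six_five, per_intCast, perZ_unitsDmat, Int.cast_ofNat]

theorem exists_units_eq {q : ℚ} (hq : q = 1 ∨ q = -1) : ∃ u : ℤˣ, q = ((u : ℤ) : ℚ) := by
  rcases hq with rfl | rfl
  exacts [⟨1, by simp⟩, ⟨-1, by simp⟩]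

theorem rowIndep_of_det_ne_zero {a : Fin 6 → Fin 6 → ℤˣ}
    (h : (Matrix.of fun i j => ((a i j : ℤ) : ℚ)).det ≠ 0) : RowIndep a := by
  intro i k s hik
  by_contra hne
  refine h ?_
  rw [← Matrix.det_updateRow_add_smul_self _ hne (-((s : ℤ) : ℚ))]
  refine Matrix.det_eq_zero_of_row_eq_zero i fun j => ?_
  simp [hik j]

theorem StdEquiv.abs_per_eq {A : Matrix (Fin 6) (Fin 6) ℚ} (h : StdEquiv A (Dmat 6 5)) :
    |per A| = 128 := by
  obtain ⟨ρ, σ, ε, δ, hε, hδ, h⟩ := h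
  choose ε' hε' using fun i => exists_units_eq (hε i)
  choose δ' hδ' using fun j => exists_units_eq (hδ j)
  have hsymm : ∀ i j, Dmat 6 5 i j = Dmat 6 5 j i := fun i j => by
    simp only [Dmat]
    refine if_congr ⟨fun h => ?_, fun h => ?_⟩ rfl rfl <;> omega
  have hA : ∀ i j, A i j = ε i * δ j * Dmat 6 5 (ρ i) (σ j) :=
    h.elim id fun h i j => by rw [h, hsymm]
  have hA' : A = fun i j => ((transform ε' δ' ρ σ unitsDmat i j : ℤ) : ℚ) := by
    ext i j
    rw [hA, hε', hδ', Dmat_six_five]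
    simp only [transform, Units.val_mul, Int.cast_mul]
  rw [hA', per_intCast, ← Int.cast_abs, abs_perZ_transform, perZ_unitsDmat]
  norm_num

theorem IsStar.stdEquiv {a : Fin 6 → Fin 6 → ℤˣ} (h : IsStar a) (ha : RowIndep a) :
    StdEquiv (fun i j => ((a i j : ℤ) : ℚ)) (Dmat 6 5) := by
  obtain ⟨ε, δ, ρ, σ, rfl⟩ := h.exists_transform ha
  have hcast : ∀ u : ℤˣ, ((u : ℤ) : ℚ) = 1 ∨ ((u : ℤ) : ℚ) = -1 := fun u => by
    rcases Int.units_eq_one_or u with rfl | rfl <;> simp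
  refine ⟨ρ, σ, fun i => ((ε i : ℤ) : ℚ), fun j => ((δ j : ℤ) : ℚ), fun i => hcast _,
    fun j => hcast _, .inl fun i j => ?_⟩
  rw [Dmat_six_five]
  simp only [transform, Units.val_mul, Int.cast_mul]

theorem order_six_nonsingular (A : Matrix (Fin 6) (Fin 6) ℚ)
    (hA : ∀ i j, A i j = 1 ∨ A i j = -1) (hdet : A.det ≠ 0) :
    |per A| ≤ per (Dmat 6 5) ∧ per (Dmat 6 5) = 128 ∧
      (|per A| = per (Dmat 6 5) ↔ StdEquiv A (Dmat 6 5)) := by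
  choose a ha using fun i j => exists_units_eq (hA i j)
  obtain rfl : A = fun i j => ((a i j : ℤ) : ℚ) := by ext i j; exact ha i j
  have hind : RowIndep a := rowIndep_of_det_ne_zero hdet
  rw [per_Dmat_six_five]
  rcases abs_perZ_lt_or_isStar hind with h | h
  · have hlt : |per fun i j => ((a i j : ℤ) : ℚ)| < 128 := by
      rw [per_intCast]
      exact_mod_cast h
    exact ⟨hlt.le, rfl, fun h => absurd h hlt.ne, StdEquiv.abs_per_eq⟩
  · have hstd := h.stdEquiv hind
    exact ⟨hstd.abs_per_eq.le, rfl, fun _ => hstd, fun _ => hstd.abs_per_eq⟩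
end
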